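/- arXiv:1612.07052 — 9 statements merged into one kernel-verified Lean document; each statement's English description precedes it below -/
import Mathlib

section
/- Let 0 ≤ a < b < ∞ and let ϱ : [a,b] → ℝ be a non-negative, non-decreasing, bounded function. Then m(ϱ,a,b) ≥ 2/(a+b); that is, (g(b) − g(a)) / ∫_a^b g(t) dt ≥ 2/(a+b). -/
open MeasureTheory Set Filter

/-- Three-chord inequality for a primitive of a non-decreasing function. -/
lemma integral_chord_of_monotoneOn {a b x : ℝ} {ρ : ℝ → ℝ}
    (hρ : MonotoneOn ρ (Set.Icc a b)) (hx : x ∈ Set.Icc a b) :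
    (b - a) * ∫ t in a..x, ρ t ≤ (x - a) * ∫ t in a..b, ρ t := by
  obtain ⟨hax, hxb⟩ := hx
  have i₁ : IntervalIntegrable ρ volume a x := by
    apply MonotoneOn.intervalIntegrable
    rw [uIcc_of_le hax]
    exact hρ.mono (Icc_subset_Icc_right hxb)
  have i₂ : IntervalIntegrable ρ volume x b := by
    apply MonotoneOn.intervalIntegrable
    rw [uIcc_of_le hxb]
    exact hρ.mono (Icc_subset_Icc_left hax)
  have left : ∫ t in a..x, ρ t ≤ (x - a) * ρ x := by
    have := intervalIntegral.integral_mono_on hax i₁ (intervalIntegrable_const (c := ρ x))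
      fun t ht => hρ ⟨ht.1, ht.2.trans hxb⟩ ⟨hax, hxb⟩ ht.2
    simpa using this
  have right : (b - x) * ρ x ≤ ∫ t in x..b, ρ t := by
    have := intervalIntegral.integral_mono_on hxb (intervalIntegrable_const (c := ρ x)) i₂
      fun t ht => hρ ⟨hax, hxb⟩ ⟨hax.trans ht.1, ht.2⟩ ht.1
    simpa using this
  rw [← intervalIntegral.integral_add_adjacent_intervals i₁ i₂]
  nlinarith [mul_le_mul_of_nonneg_left left (sub_nonneg.2 hxb),
    mul_le_mul_of_nonneg_left right (sub_nonneg.2 hax)]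

/-- Chord bound for `x * exp (h x)` from a chord bound for `h`. -/
lemma mul_exp_le_chord {a b x u v w : ℝ} (ha : 0 ≤ a) (hab : a < b)
    (hx : x ∈ Set.Icc a b) (huw : u ≤ w)
    (hv : (b - a) * (v - u) ≤ (x - a) * (w - u)) :
    x * Real.exp v ≤
      a * Real.exp u + (b * Real.exp w - a * Real.exp u) / (b - a) * (x - a) := by
  obtain ⟨hax, hxb⟩ := hx
  have hd : 0 < b - a := sub_pos.2 hab
  have hexp : Real.exp v ≤ (b - x) / (b - a) * Real.exp u + (x - a) / (b - a) * Real.exp w := by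
    have hconv := convexOn_exp.2 (mem_univ u) (mem_univ w)
      (div_nonneg (sub_nonneg.2 hxb) hd.le) (div_nonneg (sub_nonneg.2 hax) hd.le)
      (by field_simp; ring)
    simp only [smul_eq_mul] at hconv
    refine le_trans (Real.exp_le_exp.2 ?_) hconv
    rw [div_mul_eq_mul_div, div_mul_eq_mul_div, ← add_div, le_div_iff₀ hd]
    linarith
  have hE : Real.exp u ≤ Real.exp w := Real.exp_le_exp.2 huw
  refine (mul_le_mul_of_nonneg_left hexp (ha.trans hax)).trans (sub_nonneg.1 ?_)
  have key : a * Real.exp u + (b * Real.exp w - a * Real.exp u) / (b - a) * (x - a) -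
      x * ((b - x) / (b - a) * Real.exp u + (x - a) / (b - a) * Real.exp w) =
      (x - a) * (b - x) * (Real.exp w - Real.exp u) / (b - a) := by
    field_simp
    ring
  rw [key]
  exact div_nonneg (mul_nonneg (mul_nonneg (sub_nonneg.2 hax) (sub_nonneg.2 hxb))
    (sub_nonneg.2 hE)) hd.le

/-- **Lemma 8.1.** Let `0 ≤ a < b < ∞` and `ρ : [a,b] → ℝ` be a non-negative,
non-decreasing, bounded function, `h` a primitive of `ρ`, and `g x = x·exp(h x)`.
Then `m(ρ,a,b) = (g b − g a)/∫_a^b g ≥ 2/(a+b)`. -/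
theorem weighted_m_ge_two_div_add
    (a b : ℝ) (ha : 0 ≤ a) (hab : a < b)
    (ρ h g : ℝ → ℝ)
    (hρ0 : ∀ x ∈ Set.Icc a b, 0 ≤ ρ x)
    (hρmono : MonotoneOn ρ (Set.Icc a b))
    (hρbdd : ∃ C, ∀ x ∈ Set.Icc a b, ρ x ≤ C)
    (hprim : ∀ x ∈ Set.Icc a b, h x = h a + ∫ t in a..x, ρ t)
    (hg : ∀ x ∈ Set.Icc a b, g x = x * Real.exp (h x)) :
    2 / (a + b) ≤ (g b - g a) / ∫ t in a..b, g t := by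
  have hma : a ∈ Set.Icc a b := left_mem_Icc.2 hab.le
  have hmb : b ∈ Set.Icc a b := right_mem_Icc.2 hab.le
  have hd : 0 < b - a := sub_pos.2 hab
  have hle : h a ≤ h b := by
    rw [hprim b hmb]
    linarith [intervalIntegral.integral_nonneg (μ := volume) hab.le hρ0]
  have hρint : IntervalIntegrable ρ volume a b :=
    MonotoneOn.intervalIntegrable (by rwa [uIcc_of_le hab.le])
  have hcont : ContinuousOn h (Set.Icc a b) := by
    have hc := intervalIntegral.continuousOn_primitive_interval' hρint left_mem_uIcc
    rw [uIcc_of_le hab.le] at hc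
    exact (continuousOn_const.add hc).congr hprim
  have hgint : IntervalIntegrable g volume a b := by
    apply ContinuousOn.intervalIntegrable
    rw [uIcc_of_le hab.le]
    exact (continuousOn_id.mul hcont.rexp).congr hg
  have hpos : 0 < ∫ t in a..b, g t := by
    refine intervalIntegral.intervalIntegral_pos_of_pos_on hgint (fun x hx => ?_) hab
    rw [hg x (Ioo_subset_Icc_self hx)]
    exact mul_pos (ha.trans_lt hx.1) (Real.exp_pos _)
  have hchord : ∀ x ∈ Set.Icc a b, g x ≤ g a + (g b - g a) / (b - a) * (x - a) := by
    intro x hx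
    rw [hg x hx, hg a hma, hg b hmb]
    refine mul_exp_le_chord ha hab hx hle ?_
    rw [hprim x hx, hprim b hmb]
    simpa using integral_chord_of_monotoneOn hρmono hx
  have hbound : ∫ t in a..b, g t ≤ (b - a) * (g a + g b) / 2 := by
    refine (intervalIntegral.integral_mono_on hab.le hgint
      (Continuous.intervalIntegrable (by fun_prop) a b) hchord).trans_eq ?_
    rw [intervalIntegral.integral_add (by simp)
      (Continuous.intervalIntegrable (by fun_prop) a b),
      intervalIntegral.integral_const_mul, intervalIntegral.integral_sub (by simp) (by simp)]
    simp only [intervalIntegral.integral_const, integral_id, smul_eq_mul]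
    field_simp
    ring
  rw [div_le_div_iff₀ (by linarith) hpos]
  have hends : 0 ≤ a * g b - b * g a := by
    rw [hg a hma, hg b hmb]
    have := mul_nonneg (mul_nonneg ha (ha.trans hab.le))
      (sub_nonneg.2 (Real.exp_le_exp.2 hle))
    linarith
  linarith
end

section
/- Let 0 ≤ a < b < ∞ and λ > 0. Then (b·e^{λb} − a·e^{λa}) / ∫_a^b t·e^{λt} dt < λ + 2/(a+b). -/
open MeasureTheory Set Filter

/-- Chebyshev's integral inequality for the identity and a strictly increasing function. -/
theorem midpoint_mul_integral_lt_integral_id_mul {f : ℝ → ℝ} {a b : ℝ} (hab : a < b)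
    (hf : Continuous f) (hmono : StrictMono f) :
    (a + b) / 2 * ∫ t in a..b, f t < ∫ t in a..b, t * f t := by
  have h : ∫ t in a..b, (t - (a + b) / 2) * f ((a + b) / 2) <
      ∫ t in a..b, (t - (a + b) / 2) * f t := by
    apply intervalIntegral.integral_lt_integral_of_continuousOn_of_le_of_exists_lt hab
      (by fun_prop) (by fun_prop)
    · intro t _
      rcases le_total t ((a + b) / 2) with ht | ht
      · exact mul_le_mul_of_nonpos_left (hmono.monotone ht) (sub_nonpos.2 ht)
      · exact mul_le_mul_of_nonneg_left (hmono.monotone ht) (sub_nonneg.2 ht)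
    · have hb : (a + b) / 2 < b := by linarith
      exact ⟨b, right_mem_Icc.2 hab.le, mul_lt_mul_of_pos_left (hmono hb) (sub_pos.2 hb)⟩
  have hleft : ∫ t in a..b, (t - (a + b) / 2) * f ((a + b) / 2) = 0 := by
    rw [intervalIntegral.integral_mul_const, intervalIntegral.integral_sub
      (Continuous.intervalIntegrable (by fun_prop) _ _) (by simp), integral_id,
      intervalIntegral.integral_const, smul_eq_mul]
    ring
  have hright : ∫ t in a..b, (t - (a + b) / 2) * f t =
      (∫ t in a..b, t * f t) - (a + b) / 2 * ∫ t in a..b, f t := by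
    simp_rw [sub_mul]
    rw [intervalIntegral.integral_sub (Continuous.intervalIntegrable (by fun_prop) _ _)
      (Continuous.intervalIntegrable (by fun_prop) _ _), intervalIntegral.integral_const_mul]
  linarith

theorem mul_exp_sub_mul_exp_eq_integral (a b lam : ℝ) :
    b * Real.exp (lam * b) - a * Real.exp (lam * a) =
      (∫ t in a..b, Real.exp (lam * t)) + lam * ∫ t in a..b, t * Real.exp (lam * t) := by
  have hderiv (t : ℝ) : HasDerivAt (fun t ↦ t * Real.exp (lam * t))
      (Real.exp (lam * t) + lam * (t * Real.exp (lam * t))) t := by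
    refine ((hasDerivAt_id' t).fun_mul ((hasDerivAt_id' t).const_mul lam).exp).congr_deriv ?_
    ring
  rw [← intervalIntegral.integral_const_mul, ← intervalIntegral.integral_add
    (Continuous.intervalIntegrable (by fun_prop) _ _)
    (Continuous.intervalIntegrable (by fun_prop) _ _)]
  exact (intervalIntegral.integral_eq_sub_of_hasDerivAt (fun t _ ↦ hderiv t)
    (Continuous.intervalIntegrable (by fun_prop) _ _)).symm

/-- **Lemma 8.2.** Let `0 ≤ a < b < ∞` and `λ > 0`. Then
`(b·e^{λb} − a·e^{λa}) / ∫_a^b t·e^{λt} dt < λ + 2/(a+b)`. -/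
theorem m_const_lt_lambda_add_two_div_add
    (a b lam : ℝ) (ha : 0 ≤ a) (hab : a < b) (hlam : 0 < lam) :
    (b * Real.exp (lam * b) - a * Real.exp (lam * a)) /
        (∫ t in a..b, t * Real.exp (lam * t)) < lam + 2 / (a + b) := by
  have hsum : 0 < a + b := by linarith
  have hmono : StrictMono fun t ↦ Real.exp (lam * t) := fun _ _ h ↦
    Real.exp_lt_exp.2 (mul_lt_mul_of_pos_left h hlam)
  have hlt := midpoint_mul_integral_lt_integral_id_mul hab (by fun_prop) hmono
  have hexp : 0 < ∫ t in a..b, Real.exp (lam * t) :=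
    intervalIntegral.intervalIntegral_pos_of_pos
      (Continuous.intervalIntegrable (by fun_prop) _ _) (fun _ ↦ Real.exp_pos _) hab
  have hpos : 0 < ∫ t in a..b, t * Real.exp (lam * t) :=
    (mul_pos (half_pos hsum) hexp).trans hlt
  rw [mul_exp_sub_mul_exp_eq_integral, add_div, mul_div_cancel_right₀ _ hpos.ne', add_comm]
  rw [add_lt_add_iff_left, div_lt_div_iff₀ hpos hsum]
  linarith
end

section
/- Let 0 ≤ a < b < ∞ and let ϱ : [a,b] → ℝ be a non-negative, non-decreasing, bounded function. Then (i) m(ϱ,a,b) ≤ ϱ(b−) + 2/(a+b), where ϱ(b−) denotes the left limit of ϱ at b; and (ii) equality holds if and only if ϱ vanishes identically on [a,b). -/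
open MeasureTheory Set Filter

theorem MonotoneOn.mul_le_integral {ρ : ℝ → ℝ} {x y : ℝ} (hxy : x ≤ y)
    (hρ : MonotoneOn ρ (Icc x y)) : (y - x) * ρ x ≤ ∫ t in x..y, ρ t := by
  have hint : IntervalIntegrable ρ volume x y :=
    MonotoneOn.intervalIntegrable (by rwa [uIcc_of_le hxy])
  calc (y - x) * ρ x = ∫ _ in x..y, ρ x := by simp
    _ ≤ ∫ t in x..y, ρ t :=
      intervalIntegral.integral_mono_on hxy intervalIntegrable_const hint
        fun t ht => hρ (left_mem_Icc.2 hxy) ht ht.1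

theorem MonotoneOn.le_of_tendsto_nhdsLT {ρ : ℝ → ℝ} {a b L x : ℝ}
    (hρ : MonotoneOn ρ (Icc a b)) (hL : Tendsto ρ (nhdsWithin b (Iio b)) (nhds L))
    (hx : x ∈ Ico a b) : ρ x ≤ L := by
  refine ge_of_tendsto hL ?_
  filter_upwards [Ioo_mem_nhdsLT hx.2] with t ht
  exact hρ ⟨hx.1, hx.2.le⟩ ⟨hx.1.trans ht.1.le, ht.2.le⟩ ht.1.le

/-- The fundamental theorem of calculus for `x * exp (h x)`, where `h` is a primitive of a
monotone function. -/
theorem MonotoneOn.integral_exp_primitive_mul {ρ h : ℝ → ℝ} {a b : ℝ} (hab : a ≤ b)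
    (hρ : MonotoneOn ρ (Icc a b))
    (hprim : ∀ x ∈ Icc a b, h x = h a + ∫ t in a..x, ρ t) (hcont : ContinuousOn h (Icc a b))
    (hint : IntervalIntegrable (fun x => Real.exp (h x) * (1 + x * ρ x)) volume a b) :
    ∫ x in a..b, Real.exp (h x) * (1 + x * ρ x) =
      b * Real.exp (h b) - a * Real.exp (h a) := by
  have hρint : IntervalIntegrable ρ volume a b :=
    MonotoneOn.intervalIntegrable (by rwa [uIcc_of_le hab])
  refine integral_eq_of_hasDerivAt_off_countable_of_le (fun x => x * Real.exp (h x)) _ hab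
    hρ.countable_not_continuousWithinAt (by fun_prop) ?_ hint
  rintro x ⟨hx, hxs⟩
  have hnhds : Icc a b ∈ nhds x := Icc_mem_nhds hx.1 hx.2
  have hρx : ContinuousAt ρ x := by
    by_contra hc
    exact hxs ⟨Ioo_subset_Icc_self hx, fun hw => hc (hw.continuousAt hnhds)⟩
  have hmeas : StronglyMeasurableAtFilter ρ (nhds x) :=
    ⟨Ioc a b, Ioc_mem_nhds hx.1 hx.2, hρint.1.aestronglyMeasurable⟩
  have hder : HasDerivAt (fun u => h a + ∫ t in a..u, ρ t) (ρ x) x :=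
    (intervalIntegral.integral_hasDerivAt_right
      (hρint.mono_set (uIcc_subset_uIcc left_mem_uIcc
        (by rw [uIcc_of_le hab]; exact Ioo_subset_Icc_self hx))) hmeas hρx).const_add _
  have hh : HasDerivAt h (ρ x) x :=
    hder.congr_of_eventuallyEq (by filter_upwards [hnhds] with u hu using hprim u hu)
  exact ((hasDerivAt_id' x).mul hh.exp).congr_deriv (by ring)

/-- **Theorem 8.3.** Let `0 ≤ a < b < ∞` and `ρ : [a,b] → ℝ` be a non-negative,
non-decreasing, bounded function, `h` a primitive of `ρ`, `g x = x·exp(h x)` and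
`L = ρ(b−)` the left limit of `ρ` at `b`.  Then
(i) `m(ρ,a,b) = (g b − g a)/∫_a^b g ≤ L + 2/(a+b)`, and
(ii) equality holds if and only if `ρ ≡ 0` on `[a,b)`. -/
theorem m_le_left_limit_add_two_div_add
    (a b : ℝ) (ha : 0 ≤ a) (hab : a < b)
    (ρ h g : ℝ → ℝ) (L : ℝ)
    (hρ0 : ∀ x ∈ Set.Icc a b, 0 ≤ ρ x)
    (hρmono : MonotoneOn ρ (Set.Icc a b))
    (hρbdd : ∃ C, ∀ x ∈ Set.Icc a b, ρ x ≤ C)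
    (hprim : ∀ x ∈ Set.Icc a b, h x = h a + ∫ t in a..x, ρ t)
    (hg : ∀ x ∈ Set.Icc a b, g x = x * Real.exp (h x))
    (hL : Filter.Tendsto ρ (nhdsWithin b (Set.Iio b)) (nhds L)) :
    (g b - g a) / (∫ t in a..b, g t) ≤ L + 2 / (a + b) ∧
      ((g b - g a) / (∫ t in a..b, g t) = L + 2 / (a + b) ↔
        ∀ x ∈ Set.Ico a b, ρ x = 0) := by
  have hsum : 0 < a + b := by linarith
  have huIcc : uIcc a b = Icc a b := uIcc_of_le hab.le
  have hbmem : b ∈ Icc a b := right_mem_Icc.2 hab.le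
  have hρint : IntervalIntegrable ρ volume a b :=
    MonotoneOn.intervalIntegrable (by rwa [huIcc])
  have hρL : ∀ x ∈ Ico a b, ρ x ≤ L := fun x hx => hρmono.le_of_tendsto_nhdsLT hL hx
  have hcont : ContinuousOn h (Icc a b) := by
    have hp := intervalIntegral.continuousOn_primitive_interval'
      (μ := volume) hρint left_mem_uIcc
    rw [huIcc] at hp
    exact (continuousOn_const.add hp).congr hprim
  have hstep : ∀ x ∈ Icc a b, ∀ y ∈ Icc a b, x ≤ y → (y - x) * ρ x ≤ h y - h x := by
    intro x hx y hy hxy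
    have hsub : ∀ z ∈ Icc a b, IntervalIntegrable ρ volume a z := fun z hz =>
      hρint.mono_set (uIcc_subset_uIcc left_mem_uIcc (by rwa [huIcc]))
    have hdiff := intervalIntegral.integral_interval_sub_left (hsub y hy) (hsub x hx)
    have hle := MonotoneOn.mul_le_integral hxy (hρmono.mono (Icc_subset_Icc hx.1 hy.2))
    rw [hprim x hx, hprim y hy]
    linarith
  have hmono : MonotoneOn h (Icc a b) := fun x hx y hy hxy => by
    have h1 := hstep x hx y hy hxy
    have h2 := mul_nonneg (sub_nonneg.2 hxy) (hρ0 x hx)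
    linarith
  set c := (a + b) / 2 with hc
  have hcmem : c ∈ Icc a b := ⟨by linarith, by linarith⟩
  have hE : ContinuousOn (fun x => Real.exp (h x)) (uIcc a b) := by
    rw [huIcc]; fun_prop
  have hG : ContinuousOn (fun x => Real.exp (h x) * x) (uIcc a b) := by fun_prop
  have hEint := hE.intervalIntegrable (μ := volume)
  have hGint := hG.intervalIntegrable (μ := volume)
  have hGρint : IntervalIntegrable (fun x => Real.exp (h x) * x * ρ x) volume a b :=
    hρint.continuousOn_mul hG
  have hg_int : ∫ t in a..b, g t = ∫ t in a..b, Real.exp (h t) * t :=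
    intervalIntegral.integral_congr fun t ht => by
      rw [huIcc] at ht
      simp only [hg t ht, mul_comm]
  have hG_pos : 0 < ∫ t in a..b, Real.exp (h t) * t := by
    refine intervalIntegral.integral_pos hab (by rwa [huIcc] at hG)
      (fun x hx => mul_nonneg (Real.exp_pos _).le (ha.trans hx.1.le))
      ⟨b, hbmem, mul_pos (Real.exp_pos _) (ha.trans_lt hab)⟩
  have hftc : g b - g a =
      (∫ x in a..b, Real.exp (h x)) + ∫ x in a..b, Real.exp (h x) * x * ρ x := by
    have hfun : (fun x => Real.exp (h x) * (1 + x * ρ x)) =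
        fun x => Real.exp (h x) + Real.exp (h x) * x * ρ x := by
      funext x; ring
    have hi := hρmono.integral_exp_primitive_mul hab.le hprim hcont
      (by rw [hfun]; exact hEint.add hGρint)
    rw [hg b hbmem, hg a (left_mem_Icc.2 hab.le), ← hi, hfun,
      intervalIntegral.integral_add hEint hGρint]
  have hP : 0 ≤ L * (∫ x in a..b, Real.exp (h x) * x) -
      ∫ x in a..b, Real.exp (h x) * x * ρ x := by
    rw [← intervalIntegral.integral_const_mul, sub_nonneg]
    refine intervalIntegral.integral_mono_on_of_le_Ioo hab.le hGρint (hGint.const_mul L) ?_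
    intro x hx
    rw [mul_comm L]
    exact mul_le_mul_of_nonneg_left (hρL x (Ioo_subset_Ico_self hx))
      (mul_nonneg (Real.exp_pos _).le (ha.trans hx.1.le))
  have hS_eq : (∫ x in a..b, (Real.exp (h x) - Real.exp (h c)) * (x - c)) =
      (∫ x in a..b, Real.exp (h x) * x) - c * ∫ x in a..b, Real.exp (h x) := by
    have hfun : (fun x => (Real.exp (h x) - Real.exp (h c)) * (x - c)) =
        fun x => (Real.exp (h x) * x - c * Real.exp (h x)) - Real.exp (h c) * (x - c) := by
      funext x; ring
    have hlin : ∫ x in a..b, (x - c) = 0 := by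
      rw [intervalIntegral.integral_sub intervalIntegral.intervalIntegrable_id
        intervalIntegrable_const, integral_id, intervalIntegral.integral_const, smul_eq_mul, hc]
      ring
    rw [hfun, intervalIntegral.integral_sub (hGint.sub (hEint.const_mul c))
      (Continuous.intervalIntegrable (by fun_prop) _ _),
      intervalIntegral.integral_sub hGint (hEint.const_mul c),
      intervalIntegral.integral_const_mul, intervalIntegral.integral_const_mul, hlin]
    ring
  have hnonneg : ∀ x ∈ Icc a b, 0 ≤ (Real.exp (h x) - Real.exp (h c)) * (x - c) := by
    intro x hx
    rcases le_total x c with hxc | hxc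
    · exact mul_nonneg_of_nonpos_of_nonpos
        (sub_nonpos.2 (Real.exp_le_exp.2 (hmono hx hcmem hxc))) (sub_nonpos.2 hxc)
    · exact mul_nonneg (sub_nonneg.2 (Real.exp_le_exp.2 (hmono hcmem hx hxc)))
        (sub_nonneg.2 hxc)
  have hS := intervalIntegral.integral_nonneg (μ := volume) hab.le hnonneg
  have hS_pos : ∀ x ∈ Ico a b, ρ x ≠ 0 →
      0 < ∫ x in a..b, (Real.exp (h x) - Real.exp (h c)) * (x - c) := by
    intro x hx hρx
    have hxmem := Ico_subset_Icc_self hx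
    have hymem : max c x ∈ Icc a b :=
      ⟨hx.1.trans (le_max_right _ _), max_le hcmem.2 hx.2.le⟩
    have hyb : max c x < b := max_lt (by linarith) hx.2
    have hρy : 0 < ρ (max c x) :=
      (lt_of_le_of_ne (hρ0 x hxmem) hρx.symm).trans_le
        (hρmono hxmem hymem (le_max_right _ _))
    have h1 := hstep _ hymem b hbmem hyb.le
    have h2 := mul_pos (sub_pos.2 hyb) hρy
    have h3 := hmono hcmem hymem (le_max_left _ _)
    refine intervalIntegral.integral_pos hab (by fun_prop)
      (fun x hx => hnonneg x (Ioc_subset_Icc_self hx)) ⟨b, hbmem, ?_⟩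
    exact mul_pos (sub_pos.2 (Real.exp_lt_exp.2 (by linarith))) (by linarith)
  have hid : (L + 2 / (a + b)) * (∫ x in a..b, Real.exp (h x) * x) - (g b - g a) =
      (L * (∫ x in a..b, Real.exp (h x) * x) - ∫ x in a..b, Real.exp (h x) * x * ρ x) +
      2 / (a + b) * ∫ x in a..b, (Real.exp (h x) - Real.exp (h c)) * (x - c) := by
    rw [hftc, hS_eq, hc]
    field_simp
    ring
  have h2 : 0 < 2 / (a + b) := by positivity
  rw [hg_int, div_le_iff₀ hG_pos, div_eq_iff hG_pos.ne']
  refine ⟨by linarith [mul_nonneg h2.le hS], fun heq x hx => ?_, fun hzero => ?_⟩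
  · by_contra hρx
    linarith [mul_pos h2 (hS_pos x hx hρx)]
  · have hL0 : L = 0 := by
      refine tendsto_nhds_unique hL (tendsto_const_nhds.congr' ?_)
      filter_upwards [Ioo_mem_nhdsLT hab] with t ht
      exact (hzero t (Ioo_subset_Ico_self ht)).symm
    have hh : ∀ x ∈ Icc a b, h x = h a := by
      intro x hx
      rw [hprim x hx, intervalIntegral.integral_of_le hx.1, integral_Ioc_eq_integral_Ioo,
        setIntegral_congr_fun measurableSet_Ioo
          (fun t ht => hzero t ⟨ht.1.le, ht.2.trans_le hx.2⟩)]
      simp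
    have hGval : ∫ x in a..b, Real.exp (h x) * x = Real.exp (h a) * ((b ^ 2 - a ^ 2) / 2) := by
      rw [← integral_id, ← intervalIntegral.integral_const_mul]
      exact intervalIntegral.integral_congr fun t ht => by
        rw [huIcc] at ht
        simp only [hh t ht]
    rw [hGval, hL0, hg b hbmem, hg a (left_mem_Icc.2 hab.le), hh b hbmem]
    field_simp
    ring
end

section
/- Let 0 ≤ a < b < ∞ and let ϱ : [a,b] → ℝ be a non-negative, non-decreasing, bounded function. Then (i) (b−a)·m̂(ϱ,a,b) ≤ 2 + a·ϱ(a+) + b·ϱ(b−), where ϱ(a+) and ϱ(b−) denote the one-sided limits of ϱ at a and b; and (ii) equality holds if and only if ϱ vanishes identically on [a,b). Equivalently, (g(a) + g(b)) / (2 + a·ϱ(a+) + b·ϱ(b−)) ≤ (1/(b−a)) ∫_a^b g(t) dt, a reverse Hermite–Hadamard inequality. -/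
open MeasureTheory Set Filter

/-- A primitive of a monotone function is differentiable at interior continuity points. -/
lemma hasDerivAt_of_eq_primitive {a b x : ℝ} {ρ h : ℝ → ℝ} (hρ : MonotoneOn ρ (Icc a b))
    (hh : ∀ x ∈ Icc a b, h x = h a + ∫ t in a..x, ρ t) (hx : x ∈ Ioo a b)
    (hc : ContinuousWithinAt ρ (Icc a b) x) : HasDerivAt h (ρ x) x := by
  have hnhds : Icc a b ∈ nhds x := Icc_mem_nhds hx.1 hx.2
  have hint : IntervalIntegrable ρ volume a x := by
    apply MonotoneOn.intervalIntegrable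
    rw [uIcc_of_le hx.1.le]
    exact hρ.mono (Icc_subset_Icc_right hx.2.le)
  have hmeas : StronglyMeasurableAtFilter ρ (nhds x) :=
    ⟨Icc a b, hnhds, (hρ.integrableOn_isCompact (μ := volume) isCompact_Icc).1⟩
  have hd := (intervalIntegral.integral_hasDerivAt_right hint hmeas
    (hc.continuousAt hnhds)).const_add (h a)
  refine hd.congr_of_eventuallyEq ?_
  filter_upwards [hnhds] with y hy using hh y hy

lemma continuousOn_of_eq_primitive {a b : ℝ} {ρ h : ℝ → ℝ} (hab : a ≤ b)
    (hρ : IntervalIntegrable ρ volume a b)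
    (hh : ∀ x ∈ Icc a b, h x = h a + ∫ t in a..x, ρ t) : ContinuousOn h (Icc a b) := by
  have hp := intervalIntegral.continuousOn_primitive_interval' hρ left_mem_uIcc
  rw [uIcc_of_le hab] at hp
  exact (continuousOn_const.add hp).congr hh

/-- Integrating the derivative of `x ↦ x * (x * exp (h x))`, for `h` a primitive of a monotone
function `ρ`. -/
lemma two_mul_integral_add_integral_mul_exp_primitive {a b : ℝ} {ρ h : ℝ → ℝ} (hab : a ≤ b)
    (hρ : MonotoneOn ρ (Icc a b)) (hh : ∀ x ∈ Icc a b, h x = h a + ∫ t in a..x, ρ t) :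
    2 * (∫ x in a..b, x * Real.exp (h x)) + ∫ x in a..b, ρ x * (x * (x * Real.exp (h x))) =
      b * (b * Real.exp (h b)) - a * (a * Real.exp (h a)) := by
  have hρi : IntervalIntegrable ρ volume a b :=
    MonotoneOn.intervalIntegrable (by rwa [uIcc_of_le hab])
  have hcont := continuousOn_of_eq_primitive hab hρi hh
  have hg : ContinuousOn (fun x => x * Real.exp (h x)) (Icc a b) := by fun_prop
  have hxg : ContinuousOn (fun x => x * (x * Real.exp (h x))) (Icc a b) := by fun_prop
  have hgi := (hg.intervalIntegrable_of_Icc hab (μ := volume)).const_mul 2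
  have hρgi : IntervalIntegrable (fun x => ρ x * (x * (x * Real.exp (h x)))) volume a b :=
    hρi.mul_continuousOn (by rwa [uIcc_of_le hab])
  rw [← intervalIntegral.integral_const_mul, ← intervalIntegral.integral_add hgi hρgi]
  refine integral_eq_of_hasDerivAt_off_countable_of_le
    (fun x => x * (x * Real.exp (h x))) _ hab hρ.countable_not_continuousWithinAt hxg ?_
    (hgi.add hρgi)
  rintro x ⟨hx, hxs⟩
  have hc : ContinuousWithinAt ρ (Icc a b) x := by
    by_contra hc
    exact hxs ⟨Ioo_subset_Icc_self hx, hc⟩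
  have hd := hasDerivAt_of_eq_primitive hρ hh hx hc
  convert! (hasDerivAt_id x).mul ((hasDerivAt_id x).mul hd.exp) using 1
  simp only [id_eq, Pi.mul_apply]
  ring

/-- **Theorem 8.5 (reverse Hermite–Hadamard inequality).**
Let `0 ≤ a < b < ∞` and `ρ : [a,b] → ℝ` be a non-negative, non-decreasing,
bounded function, `h` a primitive of `ρ`, `g x = x·exp(h x)`,
`La = ρ(a+)` and `Lb = ρ(b−)` the one-sided limits of `ρ` at `a` and `b`, and
`m̂ = (g a + g b)/∫_a^b g`.  Then
(i) `(b−a)·m̂ ≤ 2 + a·ρ(a+) + b·ρ(b−)`, and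
(ii) equality holds if and only if `ρ ≡ 0` on `[a,b)`. -/
theorem reverse_hermite_hadamard
    (a b : ℝ) (ha : 0 ≤ a) (hab : a < b)
    (ρ h g : ℝ → ℝ) (La Lb : ℝ)
    (hρ0 : ∀ x ∈ Set.Icc a b, 0 ≤ ρ x)
    (hρmono : MonotoneOn ρ (Set.Icc a b))
    (hρbdd : ∃ C, ∀ x ∈ Set.Icc a b, ρ x ≤ C)
    (hprim : ∀ x ∈ Set.Icc a b, h x = h a + ∫ t in a..x, ρ t)
    (hg : ∀ x ∈ Set.Icc a b, g x = x * Real.exp (h x))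
    (hLa : Filter.Tendsto ρ (nhdsWithin a (Set.Ioi a)) (nhds La))
    (hLb : Filter.Tendsto ρ (nhdsWithin b (Set.Iio b)) (nhds Lb)) :
    (b - a) * ((g a + g b) / ∫ t in a..b, g t) ≤ 2 + a * La + b * Lb ∧
      ((b - a) * ((g a + g b) / ∫ t in a..b, g t) = 2 + a * La + b * Lb ↔
        ∀ x ∈ Set.Ico a b, ρ x = 0) := by
  have haI : a ∈ Icc a b := left_mem_Icc.2 hab.le
  have hbI : b ∈ Icc a b := right_mem_Icc.2 hab.le
  have hρi : IntervalIntegrable ρ volume a b :=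
    MonotoneOn.intervalIntegrable (by rwa [uIcc_of_le hab.le])
  have hcont := continuousOn_of_eq_primitive hab.le hρi hprim
  have hI : ∫ t in a..b, g t = ∫ t in a..b, t * Real.exp (h t) :=
    intervalIntegral.integral_congr (by rw [uIcc_of_le hab.le]; exact hg)
  have hid := two_mul_integral_add_integral_mul_exp_primitive hab.le hρmono hprim
  rw [hI, hg a haI, hg b hbI]
  have hgc : ContinuousOn (fun x => x * Real.exp (h x)) (Icc a b) := by fun_prop
  have hxgc : ContinuousOn (fun x => x * (x * Real.exp (h x))) (Icc a b) := by fun_prop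
  have hb : 0 < b := ha.trans_lt hab
  have hIpos : 0 < ∫ t in a..b, t * Real.exp (h t) :=
    intervalIntegral.intervalIntegral_pos_of_pos_on (hgc.intervalIntegrable_of_Icc hab.le)
      (fun x hx => mul_pos (ha.trans_lt hx.1) (Real.exp_pos _)) hab
  have hLa0 : 0 ≤ La := by
    refine ge_of_tendsto hLa ?_
    filter_upwards [Ioo_mem_nhdsGT hab] with x hx using hρ0 x (Ioo_subset_Icc_self hx)
  have hρLb : ∀ x ∈ Ico a b, ρ x ≤ Lb := by
    intro x hx
    refine ge_of_tendsto hLb ?_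
    filter_upwards [Ioo_mem_nhdsLT hx.2] with y hy
    exact hρmono (Ico_subset_Icc_self hx) ⟨hx.1.trans hy.1.le, hy.2.le⟩ hy.1.le
  have hLb0 : 0 ≤ Lb := (hρ0 a haI).trans (hρLb a ⟨le_rfl, hab⟩)
  have hhab : h a ≤ h b := by
    rw [hprim b hbI]
    exact le_add_of_nonneg_right (intervalIntegral.integral_nonneg hab.le hρ0)
  have hρg : ∫ x in a..b, ρ x * (x * (x * Real.exp (h x))) ≤
      Lb * ∫ x in a..b, x * (x * Real.exp (h x)) := by
    rw [← intervalIntegral.integral_const_mul]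
    refine intervalIntegral.integral_mono_on_of_le_Ioo hab.le
      (hρi.mul_continuousOn (by rwa [uIcc_of_le hab.le]))
      ((hxgc.intervalIntegrable_of_Icc hab.le).const_mul Lb) fun x hx => ?_
    have hx0 : 0 ≤ x := ha.trans hx.1.le
    exact mul_le_mul_of_nonneg_right (hρLb x (Ioo_subset_Ico_self hx)) (by positivity)
  have hxg : ∫ x in a..b, x * (x * Real.exp (h x)) < b * ∫ x in a..b, x * Real.exp (h x) := by
    rw [← intervalIntegral.integral_const_mul]
    refine intervalIntegral.integral_lt_integral_of_continuousOn_of_le_of_exists_lt hab hxgc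
      (continuousOn_const.mul hgc) (fun x hx => ?_) ⟨(a + b) / 2, ?_, ?_⟩
    · have hx0 : 0 ≤ x := ha.trans hx.1.le
      exact mul_le_mul_of_nonneg_right hx.2 (by positivity)
    · constructor <;> linarith
    · have hm : 0 < (a + b) / 2 := by linarith
      exact mul_lt_mul_of_pos_right (by linarith) (by positivity)
  have hends : a * (b * Real.exp (h a)) ≤ a * (b * Real.exp (h b)) := by gcongr
  have haLa : 0 ≤ a * La := mul_nonneg ha hLa0
  set I := ∫ t in a..b, t * Real.exp (h t)
  have hmul : ∀ c, Lb * ∫ x in a..b, x * (x * Real.exp (h x)) ≤ c →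
      (b - a) * (a * Real.exp (h a) + b * Real.exp (h b)) ≤ 2 * I + c + a * La * I := by
    intro c hc
    have := mul_nonneg haLa hIpos.le
    linarith
  rw [← mul_div_assoc, div_le_iff₀ hIpos, div_eq_iff hIpos.ne']
  refine ⟨?_, fun heq x hx => ?_, fun hzero => ?_⟩
  · have := hmul _ (mul_le_mul_of_nonneg_left hxg.le hLb0)
    linarith
  · have hLb_le : Lb ≤ 0 := by
      by_contra! hpos
      have := hmul _ le_rfl
      have := mul_lt_mul_of_pos_left hxg hpos
      linarith
    exact le_antisymm ((hρLb x hx).trans hLb_le) (hρ0 x (Ico_subset_Icc_self hx))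
  · have hLa_eq : La = 0 := by
      refine tendsto_nhds_unique hLa (tendsto_const_nhds.congr' ?_)
      filter_upwards [Ioo_mem_nhdsGT hab] with x hx using (hzero x (Ioo_subset_Ico_self hx)).symm
    have hLb_eq : Lb = 0 := by
      refine tendsto_nhds_unique hLb (tendsto_const_nhds.congr' ?_)
      filter_upwards [Ioo_mem_nhdsLT hab] with x hx using (hzero x (Ioo_subset_Ico_self hx)).symm
    have hρint (f : ℝ → ℝ) : ∫ x in a..b, ρ x * f x = 0 := by
      rw [intervalIntegral.integral_of_le hab.le, integral_Ioc_eq_integral_Ioo]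
      refine setIntegral_eq_zero_of_forall_eq_zero fun x hx => ?_
      rw [hzero x (Ioo_subset_Ico_self hx), zero_mul]
    have hhb : h b = h a := by
      have := hρint fun _ => 1
      simp only [mul_one] at this
      rw [hprim b hbI, this, add_zero]
    rw [hρint] at hid
    rw [hhb] at hid ⊢
    rw [hLa_eq, hLb_eq]
    linarith
end

section
/- Let 0 < a < b < ∞ and let ϱ : [a,b] → ℝ be a non-negative, non-decreasing, bounded function, and let η = (η₁,η₂) ∈ {±1}². Then: (i) there exists a pair (u, λ) with u : [a,b] → ℝ Lipschitz and λ ∈ ℝ such that u'(x) + (1/x + ϱ(x))·u(x) + λ = 0 for a.e. x ∈ (a,b), u(a) = η₁ and u(b) = η₂; (ii) this pair (u, λ) is unique; (iii) λ is given by λ = −m if η = (1,1), λ = m if η = (−1,−1), λ = m̂ if η = (1,−1), and λ = −m̂ if η = (−1,1); (iv) if η = (1,1) or η = (−1,−1) then |u| is uniformly bounded away from zero on [a,b]. -/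
open MeasureTheory Set Filter

/-- A pair `(u, lam)` solves the boundary value problem (9.4):
`u` is Lipschitz on `[a,b]` and `u' + (1/x + ρ x)·u + lam = 0` a.e. on `(a,b)`. -/
def IsLinSol (a b lam : ℝ) (ρ u : ℝ → ℝ) : Prop :=
  (∃ K : NNReal, LipschitzOnWith K u (Set.Icc a b)) ∧
    ∀ᵐ x ∂MeasureTheory.volume,
      x ∈ Set.Ioo a b → HasDerivAt u (-((1 / x + ρ x) * u x + lam)) x

open intervalIntegral in
/-- The primitive of a bounded integrable function is Lipschitz. -/
lemma exists_lipschitzOnWith_integral {a b C : ℝ} {f : ℝ → ℝ} (hab : a ≤ b)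
    (hf : IntervalIntegrable f volume a b) (hC : ∀ x ∈ Icc a b, |f x| ≤ C) :
    ∃ K : NNReal, LipschitzOnWith K (fun x => ∫ t in a..x, f t) (Icc a b) := by
  have hint : ∀ x ∈ Icc a b, IntervalIntegrable f volume a x := fun x hx =>
    hf.mono_set (by rw [uIcc_of_le hab, uIcc_of_le hx.1]; exact Icc_subset_Icc_right hx.2)
  refine ⟨C.toNNReal, LipschitzOnWith.of_dist_le_mul fun x hx y hy => ?_⟩
  have hC0 : 0 ≤ C := (abs_nonneg _).trans (hC x hx)
  rw [Real.dist_eq, Real.dist_eq, integral_interval_sub_left (hint x hx) (hint y hy),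
    Real.coe_toNNReal _ hC0, ← Real.norm_eq_abs]
  refine norm_integral_le_of_norm_le_const fun t ht => hC t ?_
  exact uIcc_subset_Icc hy hx (uIoc_subset_uIcc ht)

/-- A `C¹` function of a Lipschitz function on a compact set is Lipschitz. -/
lemma LipschitzOnWith.exists_comp_contDiffAt {α E F : Type*} [PseudoMetricSpace α]
    [NormedAddCommGroup E] [NormedSpace ℝ E] [NormedAddCommGroup F] [NormedSpace ℝ F]
    {s : Set α} (hs : IsCompact s) {φ : α → E} {K : NNReal} (hφ : LipschitzOnWith K φ s)
    {f : E → F} (hf : ∀ x ∈ s, ContDiffAt ℝ 1 f (φ x)) :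
    ∃ K', LipschitzOnWith K' (fun x => f (φ x)) s := by
  refine LocallyLipschitzOn.exists_lipschitzOnWith_of_compact hs fun x hx => ?_
  obtain ⟨K', t, ht, hK'⟩ := (hf x hx).exists_lipschitzOnWith
  refine ⟨K' * K, φ ⁻¹' t ∩ s, Filter.inter_mem
    ((hφ.continuousOn x hx).preimage_mem_nhdsWithin ht) self_mem_nhdsWithin, ?_⟩
  exact hK'.comp (hφ.mono inter_subset_right) fun y hy => hy.1

/-- The primitive of a continuous function is differentiable at interior points. -/
lemma hasDerivAt_integral_of_continuousOn {a b x : ℝ} {f : ℝ → ℝ}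
    (hf : ContinuousOn f (Icc a b)) (hx : x ∈ Ioo a b) :
    HasDerivAt (fun y => ∫ t in a..y, f t) (f x) x := by
  have hnhds : Icc a b ∈ nhds x := Icc_mem_nhds hx.1 hx.2
  refine intervalIntegral.integral_hasDerivAt_right ?_ ?_ (hf.continuousAt hnhds)
  · refine (hf.mono ?_).intervalIntegrable
    rw [uIcc_of_le hx.1.le]
    exact Icc_subset_Icc_right hx.2.le
  · exact (hf.mono Ioo_subset_Icc_self).stronglyMeasurableAtFilter isOpen_Ioo x hx

/-- An integrating factor for `1 / x + ρ`: a positive Lipschitz solution of the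
homogeneous adjoint equation. -/
structure IsIntegratingFactor (a b : ℝ) (ρ g : ℝ → ℝ) : Prop where
  pos : ∀ x ∈ Icc a b, 0 < g x
  lipschitz : ∃ K : NNReal, LipschitzOnWith K g (Icc a b)
  ae_hasDerivAt : ∀ᵐ x, x ∈ Ioo a b → HasDerivAt g ((1 / x + ρ x) * g x) x

lemma IsIntegratingFactor.continuousOn {a b : ℝ} {ρ g : ℝ → ℝ}
    (hg : IsIntegratingFactor a b ρ g) : ContinuousOn g (Icc a b) :=
  hg.lipschitz.choose_spec.continuousOn

lemma IsIntegratingFactor.intervalIntegrable {a b : ℝ} {ρ g : ℝ → ℝ} (hab : a ≤ b)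
    (hg : IsIntegratingFactor a b ρ g) : IntervalIntegrable g volume a b :=
  ContinuousOn.intervalIntegrable (by rw [uIcc_of_le hab]; exact hg.continuousOn)

lemma IsIntegratingFactor.integral_pos {a b : ℝ} {ρ g : ℝ → ℝ} (hab : a < b)
    (hg : IsIntegratingFactor a b ρ g) : 0 < ∫ t in a..b, g t :=
  intervalIntegral.intervalIntegral_pos_of_pos_on (hg.intervalIntegrable hab.le)
    (fun x hx => hg.pos x (Ioo_subset_Icc_self hx)) hab

lemma IsIntegratingFactor.exists_lipschitzOnWith_integral {a b : ℝ} {ρ g : ℝ → ℝ} (hab : a ≤ b)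
    (hg : IsIntegratingFactor a b ρ g) :
    ∃ K : NNReal, LipschitzOnWith K (fun x => ∫ t in a..x, g t) (Icc a b) := by
  obtain ⟨C, hC⟩ := isCompact_Icc.exists_bound_of_continuousOn hg.continuousOn
  exact _root_.exists_lipschitzOnWith_integral hab (hg.intervalIntegrable hab) hC

/-- `x * exp (h x)` is an integrating factor when `h` is a primitive of a bounded `ρ`. -/
lemma isIntegratingFactor_of_primitive {a b C : ℝ} (ha : 0 < a) (hab : a ≤ b) {ρ h g : ℝ → ℝ}
    (hρ : IntervalIntegrable ρ volume a b) (hC : ∀ x ∈ Icc a b, |ρ x| ≤ C)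
    (hprim : ∀ x ∈ Icc a b, h x = h a + ∫ t in a..x, ρ t)
    (hg : ∀ x ∈ Icc a b, g x = x * Real.exp (h x)) : IsIntegratingFactor a b ρ g := by
  set P : ℝ → ℝ := fun x => ∫ t in a..x, ρ t with hP
  have hgP : EqOn g (fun x => x * Real.exp (h a + P x)) (Icc a b) := fun x hx => by
    simp only [hg x hx, hprim x hx, hP]
  refine ⟨fun x hx => ?_, ?_, ?_⟩
  · rw [hg x hx]
    exact mul_pos (ha.trans_le hx.1) (Real.exp_pos _)
  · obtain ⟨K, hK⟩ := exists_lipschitzOnWith_integral hab hρ hC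
    obtain ⟨K', hK'⟩ := (LipschitzWith.id.lipschitzOnWith.prodMk hK).exists_comp_contDiffAt
      isCompact_Icc (f := fun p : ℝ × ℝ => p.1 * Real.exp (h a + p.2))
      fun x _ => by fun_prop
    exact ⟨K', fun x hx y hy => by rw [hgP hx, hgP hy]; exact hK' hx hy⟩
  · filter_upwards [hρ.ae_hasDerivAt_integral] with x hd hx
    have hx' := Ioo_subset_Icc_self hx
    have hx0 : x ≠ 0 := (ha.trans hx.1).ne'
    have hdP : HasDerivAt P (ρ x) x :=
      hd (by rwa [uIcc_of_le hab]) a left_mem_uIcc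
    have hdg := ((hasDerivAt_id x).mul (hdP.const_add (h a)).exp).congr_of_eventuallyEq
      (hgP.eventuallyEq_of_mem (Icc_mem_nhds hx.1 hx.2))
    refine hdg.congr_deriv ?_
    rw [hgP hx']
    simp only [id]
    field_simp

/-- Variation of constants: every solution satisfies the integrated equation. -/
lemma IsLinSol.mul_eq {a b lam : ℝ} {ρ g u : ℝ → ℝ} (hab : a ≤ b)
    (hg : IsIntegratingFactor a b ρ g) (hu : IsLinSol a b lam ρ u) {x : ℝ} (hx : x ∈ Icc a b) :
    g x * u x = g a * u a - lam * ∫ t in a..x, g t := by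
  obtain ⟨⟨Ku, hKu⟩, hdu⟩ := hu
  obtain ⟨Kg, hKg⟩ := hg.lipschitz
  obtain ⟨KP, hKP⟩ := hg.exists_lipschitzOnWith_integral hab
  rw [← uIcc_of_le hab] at hKu hKg hKP
  have hac := (hKg.absolutelyContinuousOnInterval.mul hKu.absolutelyContinuousOnInterval).add
    (hKP.absolutelyContinuousOnInterval.const_mul lam)
  obtain ⟨c, hc⟩ := hac.const_of_ae_hasDerivAt_zero <| by
    filter_upwards [hg.ae_hasDerivAt, hdu, volume.ae_ne a, volume.ae_ne b]
      with y hgy huy hya hyb hy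
    rw [uIcc_of_le hab] at hy
    have hy' : y ∈ Ioo a b := ⟨lt_of_le_of_ne hy.1 hya.symm, lt_of_le_of_ne hy.2 hyb⟩
    refine (((hgy hy').mul (huy hy')).add
      ((hasDerivAt_integral_of_continuousOn hg.continuousOn hy').const_mul lam)).congr_deriv ?_
    ring
  rw [uIcc_of_le hab] at hc
  have hxa := (hc x hx).trans (hc a (left_mem_Icc.2 hab)).symm
  simp only [Pi.add_apply, Pi.mul_apply, intervalIntegral.integral_same] at hxa
  linarith

/-- Variation of constants: the integrated equation defines a solution. -/
lemma IsIntegratingFactor.isLinSol {a b : ℝ} {ρ g : ℝ → ℝ} (hab : a ≤ b)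
    (hg : IsIntegratingFactor a b ρ g) (c lam : ℝ) :
    IsLinSol a b lam ρ (fun x => (c - lam * ∫ t in a..x, g t) / g x) := by
  constructor
  · obtain ⟨Kg, hKg⟩ := hg.lipschitz
    obtain ⟨KP, hKP⟩ := hg.exists_lipschitzOnWith_integral hab
    exact (hKP.prodMk hKg).exists_comp_contDiffAt isCompact_Icc
      (f := fun p : ℝ × ℝ => (c - lam * p.1) / p.2)
      fun x hx => ContDiffAt.div (by fun_prop) (by fun_prop) (hg.pos x hx).ne'
  · filter_upwards [hg.ae_hasDerivAt] with x hgx hx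
    have hgx0 := (hg.pos x (Ioo_subset_Icc_self hx)).ne'
    refine ((((hasDerivAt_integral_of_continuousOn hg.continuousOn hx).const_mul lam).const_sub
      c).div (hgx hx) hgx0).congr_deriv ?_
    field_simp
    ring

/-- The parameter of a solution is determined by its boundary values. -/
lemma IsLinSol.parameter_eq {a b lam : ℝ} {ρ g u : ℝ → ℝ} (hab : a < b)
    (hg : IsIntegratingFactor a b ρ g) (hu : IsLinSol a b lam ρ u) :
    lam = (g a * u a - g b * u b) / ∫ t in a..b, g t := by
  rw [eq_div_iff (hg.integral_pos hab).ne', hu.mul_eq hab.le hg (right_mem_Icc.2 hab.le)]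
  ring

/-- **Lemma 9.2.** Let `0 < a < b < ∞`, `ρ` non-negative non-decreasing bounded on
`[a,b]`, `h` a primitive of `ρ`, `g x = x e^{h x}`,
`m = (g b − g a)/∫_a^b g`, `m̂ = (g a + g b)/∫_a^b g`, and `η = (η₁,η₂) ∈ {±1}²`.
Then (i) there is a solution `(u,lam)` of `u' + (1/x+ρ)u + lam = 0` a.e. on `(a,b)`
with `u a = η₁`, `u b = η₂`; (ii) it is unique; (iii) `lam = −m, m, m̂, −m̂` according
to `η = (1,1), (−1,−1), (1,−1), (−1,1)`; (iv) if `η₁ = η₂` then `|u|` is uniformly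
bounded away from zero on `[a,b]`. -/
theorem linear_bvp_existence_uniqueness
    (a b : ℝ) (ha : 0 < a) (hab : a < b)
    (ρ h g : ℝ → ℝ)
    (hρ0 : ∀ x ∈ Set.Icc a b, 0 ≤ ρ x)
    (hρmono : MonotoneOn ρ (Set.Icc a b))
    (hρbdd : ∃ C, ∀ x ∈ Set.Icc a b, ρ x ≤ C)
    (hprim : ∀ x ∈ Set.Icc a b, h x = h a + ∫ t in a..x, ρ t)
    (hg : ∀ x ∈ Set.Icc a b, g x = x * Real.exp (h x))
    (η₁ η₂ : ℝ) (hη₁ : η₁ = 1 ∨ η₁ = -1) (hη₂ : η₂ = 1 ∨ η₂ = -1) :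
    (∃ u lam, IsLinSol a b lam ρ u ∧ u a = η₁ ∧ u b = η₂) ∧
    (∀ u₁ lam₁ u₂ lam₂,
        IsLinSol a b lam₁ ρ u₁ ∧ u₁ a = η₁ ∧ u₁ b = η₂ →
        IsLinSol a b lam₂ ρ u₂ ∧ u₂ a = η₁ ∧ u₂ b = η₂ →
        lam₁ = lam₂ ∧ ∀ x ∈ Set.Icc a b, u₁ x = u₂ x) ∧
    (∀ u lam, IsLinSol a b lam ρ u ∧ u a = η₁ ∧ u b = η₂ →
        ((η₁ = 1 ∧ η₂ = 1) → lam = -((g b - g a) / ∫ t in a..b, g t)) ∧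
        ((η₁ = -1 ∧ η₂ = -1) → lam = (g b - g a) / ∫ t in a..b, g t) ∧
        ((η₁ = 1 ∧ η₂ = -1) → lam = (g a + g b) / ∫ t in a..b, g t) ∧
        ((η₁ = -1 ∧ η₂ = 1) → lam = -((g a + g b) / ∫ t in a..b, g t))) ∧
    (∀ u lam, IsLinSol a b lam ρ u ∧ u a = η₁ ∧ u b = η₂ → η₁ = η₂ →
        ∃ ε > 0, ∀ x ∈ Set.Icc a b, ε ≤ |u x|) := by
  obtain ⟨C, hC⟩ := hρbdd
  have hρint : IntervalIntegrable ρ volume a b :=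
    MonotoneOn.intervalIntegrable (by rwa [uIcc_of_le hab.le])
  have hG : IsIntegratingFactor a b ρ g := isIntegratingFactor_of_primitive ha hab.le hρint
    (fun x hx => (abs_of_nonneg (hρ0 x hx)).trans_le (hC x hx)) hprim hg
  have haI : a ∈ Icc a b := left_mem_Icc.2 hab.le
  have hbI : b ∈ Icc a b := right_mem_Icc.2 hab.le
  have hga := hG.pos a haI
  have hgb := hG.pos b hbI
  have hI := hG.integral_pos hab
  refine ⟨?_, ?_, ?_, ?_⟩
  · refine ⟨_, _, hG.isLinSol hab.le (g a * η₁) ((g a * η₁ - g b * η₂) / ∫ t in a..b, g t), ?_, ?_⟩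
    · simp only [intervalIntegral.integral_same]
      field_simp
      ring
    · field_simp
      ring
  · rintro u₁ lam₁ u₂ lam₂ ⟨h₁, h₁a, h₁b⟩ ⟨h₂, h₂a, h₂b⟩
    have hlam : lam₁ = lam₂ := by
      rw [h₁.parameter_eq hab hG, h₂.parameter_eq hab hG, h₁a, h₁b, h₂a, h₂b]
    refine ⟨hlam, fun x hx => mul_left_cancel₀ (hG.pos x hx).ne' ?_⟩
    rw [h₁.mul_eq hab.le hG hx, h₂.mul_eq hab.le hG hx, h₁a, h₂a, hlam]
  · rintro u lam ⟨hu, hua, hub⟩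
    rw [hu.parameter_eq hab hG, hua, hub]
    refine ⟨?_, ?_, ?_, ?_⟩ <;> rintro ⟨rfl, rfl⟩ <;> ring
  · rintro u lam ⟨hu, hua, hub⟩ rfl
    have hgmono : MonotoneOn g (Icc a b) := by
      have hhmono : MonotoneOn h (Icc a b) := fun x hx y hy hxy => by
        have hint : ∀ z ∈ Icc a b, IntervalIntegrable ρ volume a z := fun z hz =>
          hρint.mono_set (by
            rw [uIcc_of_le hab.le, uIcc_of_le hz.1]; exact Icc_subset_Icc_right hz.2)
        have hnonneg : 0 ≤ ∫ t in x..y, ρ t := intervalIntegral.integral_nonneg hxy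
          fun t ht => hρ0 t ⟨hx.1.trans ht.1, ht.2.trans hy.2⟩
        rw [← intervalIntegral.integral_interval_sub_left (hint y hy) (hint x hx)] at hnonneg
        linarith [hprim x hx, hprim y hy]
      intro x hx y hy hxy
      rw [hg x hx, hg y hy]
      exact mul_le_mul hxy (Real.exp_le_exp.2 (hhmono hx hy hxy)) (Real.exp_pos _).le
        (ha.le.trans hy.1)
    refine ⟨g a / g b, div_pos hga hgb, fun x hx => ?_⟩
    have hgx := hG.pos x hx
    have hP : 0 ≤ ∫ t in a..x, g t := intervalIntegral.integral_nonneg hx.1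
      fun t ht => (hG.pos t ⟨ht.1, ht.2.trans hx.2⟩).le
    have hm : 0 ≤ (g b - g a) / (∫ t in a..b, g t) :=
      div_nonneg (sub_nonneg.2 (hgmono haI hbI hab.le)) hI.le
    have hη : |u a| = 1 := by rw [hua]; rcases hη₁ with h | h <;> simp [h]
    have hform : g x * u x = (g a + (g b - g a) / (∫ t in a..b, g t) * ∫ t in a..x, g t) * u a := by
      rw [hu.mul_eq hab.le hG hx, hu.parameter_eq hab hG, hub, hua]
      ring
    have habs := congrArg abs hform
    rw [abs_mul, abs_mul, hη, mul_one, abs_of_pos hgx,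
      abs_of_pos (add_pos_of_pos_of_nonneg hga (mul_nonneg hm hP))] at habs
    rw [div_le_iff₀ hgb]
    calc g a ≤ g x * |u x| := by rw [habs]; exact le_add_of_nonneg_right (mul_nonneg hm hP)
      _ ≤ g b * |u x| := mul_le_mul_of_nonneg_right (hgmono hx hbI hx.2) (abs_nonneg _)
      _ = |u x| * g b := mul_comm _ _
end

section
/- Let 0 < a < b < ∞ and let ϱ : [a,b] → ℝ be a non-negative, non-decreasing, bounded function. Let (u, λ) with u : [a,b] → ℝ Lipschitz and λ ∈ ℝ satisfy u'(x) + (1/x + ϱ(x))·u(x) + λ = 0 for a.e. x ∈ (a,b), u(a) = 1 and u(b) = −1. Then: (i) there exists a unique c ∈ (a,b) with u(c) = 0; (ii) u'(x) < 0 for a.e. x ∈ [a,c] and u is strictly decreasing on [a,c]. -/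
open MeasureTheory Set Filter

/-- An absolutely continuous function whose derivative is at most `K` almost everywhere grows at
rate at most `K`. -/
theorem AbsolutelyContinuousOnInterval.sub_le_of_ae_hasDerivAt_le {f f' : ℝ → ℝ} {s t K : ℝ}
    (hf : AbsolutelyContinuousOnInterval f s t) (hst : s ≤ t)
    (hd : ∀ᵐ x, x ∈ Ioo s t → HasDerivAt f (f' x) x)
    (hK : ∀ x ∈ Ioo s t, f' x ≤ K) : f t - f s ≤ K * (t - s) := by
  rw [← hf.integral_deriv_eq_sub]
  have hconst : ∫ _ in s..t, K = K * (t - s) := by simp [mul_comm]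
  rw [← hconst]
  refine intervalIntegral.integral_mono_ae_restrict hst hf.intervalIntegrable_deriv
    intervalIntegrable_const ?_
  rw [← Measure.restrict_congr_set Ioo_ae_eq_Icc]
  refine (ae_restrict_iff' measurableSet_Ioo).2 ?_
  filter_upwards [hd] with x hx hxs
  rw [(hx hxs).deriv]
  exact hK x hxs

/-- A nonpositive solution of `u' + q u + l = 0` with `q ≤ M` and `0 ≤ l` decreases after
multiplication by `exp (M x)`. -/
theorem exp_mul_sub_le_of_nonpos {u q : ℝ → ℝ} {s t M l : ℝ}
    (hu : AbsolutelyContinuousOnInterval u s t) (hst : s ≤ t) (hM : 0 ≤ M) (hl : 0 ≤ l)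
    (hode : ∀ᵐ x, x ∈ Ioo s t → HasDerivAt u (-(q x * u x + l)) x)
    (hq : ∀ x ∈ Ioo s t, q x ≤ M) (hneg : ∀ x ∈ Ioo s t, u x ≤ 0) :
    Real.exp (M * t) * u t - Real.exp (M * s) * u s ≤ -(l * Real.exp (M * s)) * (t - s) := by
  have hE : AbsolutelyContinuousOnInterval (fun x ↦ Real.exp (M * x)) s t :=
    ContDiffOn.absolutelyContinuousOnInterval (by fun_prop)
  refine (hE.fun_mul hu).sub_le_of_ae_hasDerivAt_le hst
    (f' := fun x ↦ Real.exp (M * x) * ((M - q x) * u x - l)) ?_ fun x hx ↦ ?_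
  · filter_upwards [hode] with x hx hxs
    have h1 : HasDerivAt (fun x ↦ Real.exp (M * x)) (Real.exp (M * x) * (M * 1)) x :=
      ((hasDerivAt_id x).const_mul M).exp
    exact (h1.fun_mul (hx hxs)).congr_deriv (by ring)
  · have h1 : Real.exp (M * s) ≤ Real.exp (M * x) :=
      Real.exp_le_exp.2 (mul_le_mul_of_nonneg_left hx.1.le hM)
    have h2 : (M - q x) * u x ≤ 0 :=
      mul_nonpos_of_nonneg_of_nonpos (sub_nonneg.2 (hq x hx)) (hneg x hx)
    nlinarith [mul_nonpos_of_nonneg_of_nonpos (Real.exp_pos (M * x)).le h2,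
      mul_le_mul_of_nonneg_left h1 hl]

/-- A function continuous on `[s, t]` that is positive at `s` and nonpositive at `t` has a first
zero. -/
theorem exists_first_zero {u : ℝ → ℝ} {s t : ℝ} (hu : ContinuousOn u (Icc s t)) (hst : s ≤ t)
    (hs : 0 < u s) (ht : u t ≤ 0) :
    ∃ c ∈ Ioc s t, u c = 0 ∧ ∀ x ∈ Ico s c, 0 < u x := by
  have hpre {x : ℝ} (hx : x ∈ Icc s t) (hux : u x ≤ 0) : ∃ z ∈ Icc s x, u z = 0 :=
    intermediate_value_Icc' hx.1 (hu.mono (Icc_subset_Icc_right hx.2)) ⟨hux, hs.le⟩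
  have hcomp : IsCompact (Icc s t ∩ u ⁻¹' {0}) :=
    isCompact_Icc.of_isClosed_subset (hu.preimage_isClosed_of_isClosed isClosed_Icc
      isClosed_singleton) inter_subset_left
  obtain ⟨z, hz, hz0⟩ := hpre ⟨hst, le_rfl⟩ ht
  obtain ⟨c, ⟨hc, hc0⟩, hmin⟩ := hcomp.exists_isLeast ⟨z, hz, hz0⟩
  have hc0 : u c = 0 := hc0
  refine ⟨c, ⟨hc.1.lt_of_ne ?_, hc.2⟩, hc0, fun x hx ↦ ?_⟩
  · rintro rfl
    exact hs.ne' hc0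
  · by_contra! hux
    obtain ⟨z, hz, hz0⟩ := hpre ⟨hx.1, hx.2.le.trans hc.2⟩ hux
    exact (hmin ⟨⟨hz.1, hz.2.trans (hx.2.le.trans hc.2)⟩, hz0⟩).not_gt (hz.2.trans_lt hx.2)

/-- A function continuous on `[s, t]` that is nonpositive at `s` and positive at `t` has a last
zero. -/
theorem exists_last_zero {u : ℝ → ℝ} {s t : ℝ} (hu : ContinuousOn u (Icc s t)) (hst : s ≤ t)
    (hs : u s ≤ 0) (ht : 0 < u t) :
    ∃ c ∈ Ico s t, u c = 0 ∧ ∀ x ∈ Ioc c t, 0 < u x := by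
  obtain ⟨c, hc, hc0, hpos⟩ := exists_first_zero (u := fun x ↦ u (-x)) (s := -t) (t := -s)
    (hu.comp continuous_neg.continuousOn fun x hx ↦ ⟨le_neg.1 hx.2, neg_le.1 hx.1⟩)
    (neg_le_neg hst) (by simpa using ht) (by simpa using hs)
  refine ⟨-c, ⟨le_neg.1 hc.2, neg_lt.1 hc.1⟩, hc0, fun x hx ↦ ?_⟩
  simpa using hpos (-x) ⟨neg_le_neg hx.2, neg_lt.1 hx.1⟩

/-- **Lemma 9.3.** Let `0 < a < b < ∞`, `ρ` non-negative non-decreasing bounded on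
`[a,b]`, and let `(u, lam)` solve `u' + (1/x + ρ)u + lam = 0` a.e. on `(a,b)`
with `u a = 1` and `u b = −1`.  Then (i) there exists a unique `c ∈ (a,b)` with
`u c = 0`; (ii) `u' < 0` a.e. on `[a,c]` and `u` is strictly decreasing
on `[a,c]`. -/
theorem linear_bvp_unique_zero
    (a b lam : ℝ) (ha : 0 < a) (hab : a < b)
    (ρ u : ℝ → ℝ)
    (hρ0 : ∀ x ∈ Set.Icc a b, 0 ≤ ρ x)
    (hρmono : MonotoneOn ρ (Set.Icc a b))
    (hρbdd : ∃ C, ∀ x ∈ Set.Icc a b, ρ x ≤ C)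
    (hlip : ∃ K : NNReal, LipschitzOnWith K u (Set.Icc a b))
    (hode : ∀ᵐ x ∂MeasureTheory.volume,
      x ∈ Set.Ioo a b → HasDerivAt u (-((1 / x + ρ x) * u x + lam)) x)
    (hua : u a = 1) (hub : u b = -1) :
    ∃ c ∈ Set.Ioo a b, u c = 0 ∧ (∀ c' ∈ Set.Ioo a b, u c' = 0 → c' = c) ∧
      (∀ᵐ x ∂MeasureTheory.volume,
        x ∈ Set.Icc a c → ∀ d, HasDerivAt u d x → d < 0) ∧
      StrictAntiOn u (Set.Icc a c) := by
  obtain ⟨C, hC⟩ := hρbdd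
  obtain ⟨K, hK⟩ := hlip
  have hcont : ContinuousOn u (Icc a b) := hK.continuousOn
  have hac {s t : ℝ} (hs : a ≤ s) (hst : s ≤ t) (ht : t ≤ b) :
      AbsolutelyContinuousOnInterval u s t := by
    refine LipschitzOnWith.absolutelyContinuousOnInterval (K := K) (hK.mono ?_)
    rw [uIcc_of_le hst]
    exact Icc_subset_Icc hs ht
  have hq0 : ∀ x ∈ Icc a b, 0 ≤ 1 / x + ρ x := fun x hx ↦
    add_nonneg (one_div_nonneg.2 (ha.le.trans hx.1)) (hρ0 x hx)
  have hqM : ∀ x ∈ Icc a b, 1 / x + ρ x ≤ 1 / a + C := fun x hx ↦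
    add_le_add (one_div_le_one_div_of_le ha hx.1) (hC x hx)
  have hM : 0 ≤ 1 / a + C :=
    (hq0 a (left_mem_Icc.2 hab.le)).trans (hqM a (left_mem_Icc.2 hab.le))
  obtain ⟨c, hc, hc0, hpos⟩ := exists_first_zero hcont hab.le (hua ▸ one_pos) (by simp [hub])
  have hcb : c < b := hc.2.lt_of_ne (by rintro rfl; linarith)
  have hlam : 0 < lam := by
    by_contra! hlam
    have h := exp_mul_sub_le_of_nonpos (u := fun x ↦ -u x) (q := fun x ↦ 1 / x + ρ x)
      (hac le_rfl hc.1.le hc.2).neg hc.1.le hM (neg_nonneg.2 hlam)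
      (by
        filter_upwards [hode] with x hx hxs
        exact (hx ⟨hxs.1, hxs.2.trans hcb⟩).fun_neg.congr_deriv (by ring))
      (fun x hx ↦ hqM x ⟨hx.1.le, hx.2.le.trans hc.2⟩)
      (fun x hx ↦ neg_nonpos.2 (hpos x ⟨hx.1.le, hx.2⟩).le)
    simp only [hc0, hua] at h
    have hE := Real.exp_pos ((1 / a + C) * a)
    nlinarith [mul_nonneg (mul_nonneg (neg_nonneg.2 hlam) hE.le) (sub_nonneg.2 hc.1.le)]
  have hanti {s t : ℝ} (hs : a ≤ s) (hst : s < t) (ht : t ≤ b)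
      (hnn : ∀ x ∈ Ioo s t, 0 ≤ u x) : u t < u s := by
    have h := (hac hs hst.le ht).sub_le_of_ae_hasDerivAt_le hst.le
      (f' := fun x ↦ -((1 / x + ρ x) * u x + lam)) (K := -lam)
      (by
        filter_upwards [hode] with x hx hxs
        exact hx ⟨hs.trans_lt hxs.1, hxs.2.trans_le ht⟩)
      (fun x hx ↦ by
        have := mul_nonneg (hq0 x ⟨hs.trans hx.1.le, hx.2.le.trans ht⟩) (hnn x hx)
        linarith)
    nlinarith [mul_pos hlam (sub_pos.2 hst)]
  have hno_zero {s t : ℝ} (hs : a ≤ s) (hst : s < t) (ht : t ≤ b) (hs0 : u s = 0) : u t ≠ 0 := by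
    intro ht0
    have hneg : ∀ x ∈ Ioo s t, u x ≤ 0 := by
      intro x hx
      by_contra! hux
      obtain ⟨z, hz, hz0, hzpos⟩ := exists_last_zero
        (hcont.mono (Icc_subset_Icc hs (hx.2.le.trans ht))) hx.1.le hs0.le hux
      have := hanti (hs.trans hz.1) hz.2 (hx.2.le.trans ht)
        (fun y hy ↦ (hzpos y ⟨hy.1, hy.2.le⟩).le)
      linarith
    have h := exp_mul_sub_le_of_nonpos (q := fun x ↦ 1 / x + ρ x) (hac hs hst.le ht) hst.le hM
      hlam.le
      (by
        filter_upwards [hode] with x hx hxs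
        exact hx ⟨hs.trans_lt hxs.1, hxs.2.trans_le ht⟩)
      (fun x hx ↦ hqM x ⟨hs.trans hx.1.le, hx.2.le.trans ht⟩) hneg
    simp only [hs0, ht0] at h
    nlinarith [mul_pos (mul_pos hlam (Real.exp_pos ((1 / a + C) * s))) (sub_pos.2 hst)]
  refine ⟨c, ⟨hc.1, hcb⟩, hc0, fun d hd hd0 ↦ ?_, ?_, fun x hx y hy hxy ↦ ?_⟩
  · rcases lt_trichotomy d c with h | h | h
    · exact absurd hd0 (hno_zero hd.1.le h hc.2 · hc0)
    · exact h
    · exact absurd hd0 (hno_zero hc.1.le h hd.2.le hc0)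
  · filter_upwards [hode, Measure.ae_ne volume a] with x hx hxa hxs d hd
    have hxa' : a < x := hxs.1.lt_of_ne' hxa
    rw [hd.unique (hx ⟨hxa', hxs.2.trans_lt hcb⟩)]
    have hux : 0 ≤ u x := by
      rcases hxs.2.eq_or_lt with rfl | h
      · exact hc0.ge
      · exact (hpos x ⟨hxs.1, h⟩).le
    have := mul_nonneg (hq0 x ⟨hxs.1, hxs.2.trans hc.2⟩) hux
    linarith
  · exact hanti hx.1 hxy (hy.2.trans hc.2)
      (fun z hz ↦ (hpos z ⟨hx.1.trans hz.1.le, hz.2.trans_le hy.2⟩).le)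
end

section
/- Let 0 < a < b < ∞ and define w₀ : [a,b] → ℝ by w₀(τ) := (a+b)τ/(ab + τ²). Then: (i) w₀ is Lipschitz on [a,b], satisfies w₀'(τ) + (2/(a+b))·w₀(τ)² = w₀(τ)/τ on (a,b), and w₀(a) = w₀(b) = 1 (i.e. (w₀, 2/(a+b)) solves the Riccati boundary value problem for ϱ ≡ 0); (ii) sup_{τ ∈ [a,b]} w₀(τ) = (a+b)/(2√(ab)); (iii) ∫_a^b 1/(τ·√(w₀(τ)² − 1)) dτ = π. -/
open MeasureTheory Set Filter

lemma abs_model_sub_le {a b x y : ℝ} (ha : 0 < a) (hb : 0 < b) (hx : 0 < x) (hy : 0 < y) :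
    |(a + b) * x / (a * b + x ^ 2) - (a + b) * y / (a * b + y ^ 2)| ≤
      (a + b) / (a * b) * |x - y| := by
  have hab : 0 < a * b := mul_pos ha hb
  have hxy : 0 < x * y := mul_pos hx hy
  have hX : 0 < a * b + x ^ 2 := by positivity
  have hY : 0 < a * b + y ^ 2 := by positivity
  have hsub : (a + b) * x / (a * b + x ^ 2) - (a + b) * y / (a * b + y ^ 2) =
      (a + b) * ((a * b - x * y) / ((a * b + x ^ 2) * (a * b + y ^ 2))) * (x - y) := by
    field_simp
    ring
  have hbound : |(a * b - x * y) / ((a * b + x ^ 2) * (a * b + y ^ 2))| ≤ 1 / (a * b) := by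
    rw [abs_div, abs_of_pos (mul_pos hX hY), div_le_div_iff₀ (mul_pos hX hY) hab]
    have hnum : |a * b - x * y| ≤ a * b + x * y := abs_le.2 ⟨by linarith, by linarith⟩
    nlinarith [mul_le_mul_of_nonneg_right hnum hab.le, mul_nonneg hab.le (sq_nonneg (x - y)),
      mul_pos hab hxy, mul_pos hxy hxy]
  rw [hsub, abs_mul, abs_mul, abs_of_pos (add_pos ha hb), div_eq_mul_one_div (a + b)]
  gcongr

lemma hasDerivAt_model {a b x : ℝ} (ha : 0 < a) (hb : 0 < b) (hx : 0 < x) :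
    HasDerivAt (fun τ : ℝ => (a + b) * τ / (a * b + τ ^ 2))
      ((a + b) * x / (a * b + x ^ 2) / x -
        2 / (a + b) * ((a + b) * x / (a * b + x ^ 2)) ^ 2) x := by
  have hX : a * b + x ^ 2 ≠ 0 := by positivity
  have hs : a + b ≠ 0 := by positivity
  have h := ((hasDerivAt_id x).const_mul (a + b)).div
    (((hasDerivAt_id x).pow 2).const_add (a * b)) hX
  refine h.congr_deriv ?_
  simp only [id, Pi.pow_apply, Nat.cast_ofNat]
  field_simp
  ring

lemma isGreatest_model_image {a b : ℝ} (ha : 0 < a) (hab : a < b) :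
    IsGreatest ((fun τ : ℝ => (a + b) * τ / (a * b + τ ^ 2)) '' Icc a b)
      ((a + b) / (2 * √(a * b))) := by
  have hb : 0 < b := ha.trans hab
  have hm : 0 < √(a * b) := Real.sqrt_pos.2 (mul_pos ha hb)
  have hsq : √(a * b) ^ 2 = a * b := Real.sq_sqrt (mul_pos ha hb).le
  refine ⟨⟨√(a * b), ⟨Real.le_sqrt_of_sq_le (by nlinarith),
    Real.sqrt_le_iff.2 ⟨hb.le, by nlinarith⟩⟩, ?_⟩, ?_⟩
  · change (a + b) * √(a * b) / (a * b + √(a * b) ^ 2) = _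
    rw [div_eq_div_iff (by positivity) (by positivity)]
    linear_combination (a + b) * hsq
  · rintro _ ⟨x, hx, rfl⟩
    have hx0 : 0 < x := ha.trans_le hx.1
    change (a + b) * x / (a * b + x ^ 2) ≤ _
    rw [div_le_div_iff₀ (by positivity) (by positivity)]
    have h := mul_nonneg (add_pos ha hb).le (sq_nonneg (x - √(a * b)))
    linear_combination h + (a + b) * hsq

lemma hasDerivAt_arcsin_model {a b x : ℝ} (ha : 0 < a) (hx : x ∈ Ioo a b) :
    HasDerivAt (fun τ : ℝ => Real.arcsin ((τ - a * b / τ) / (b - a)))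
      (1 / (x * √(((a + b) * x / (a * b + x ^ 2)) ^ 2 - 1))) x := by
  obtain ⟨hax, hxb⟩ := hx
  have hx0 : 0 < x := ha.trans hax
  have hb : 0 < b := hx0.trans hxb
  have hd : 0 < b - a := by linarith
  have hX : 0 < a * b + x ^ 2 := by positivity
  have hN : 0 < (x ^ 2 - a ^ 2) * (b ^ 2 - x ^ 2) := mul_pos (by nlinarith) (by nlinarith)
  have hw : ((a + b) * x / (a * b + x ^ 2)) ^ 2 - 1 =
      (x ^ 2 - a ^ 2) * (b ^ 2 - x ^ 2) / (a * b + x ^ 2) ^ 2 := by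
    field_simp
    ring
  have hs : 1 - ((x - a * b / x) / (b - a)) ^ 2 =
      (x ^ 2 - a ^ 2) * (b ^ 2 - x ^ 2) / (x * (b - a)) ^ 2 := by
    field_simp
    ring
  have hpos : 0 < 1 - ((x - a * b / x) / (b - a)) ^ 2 := by
    rw [hs]
    positivity
  have hinner : HasDerivAt (fun τ : ℝ => (τ - a * b / τ) / (b - a))
      ((1 + a * b / x ^ 2) / (b - a)) x := by
    have h := (((hasDerivAt_id x).sub ((hasDerivAt_inv hx0.ne').const_mul (a * b))).div_const
      (b - a))
    refine h.congr_deriv ?_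
    field_simp
    ring
  have h := (Real.hasDerivAt_arcsin (x := (x - a * b / x) / (b - a))
    (fun h => by rw [h] at hpos; norm_num at hpos)
    (fun h => by rw [h] at hpos; norm_num at hpos)).comp x hinner
  refine h.congr_deriv ?_
  rw [hs, hw, Real.sqrt_div hN.le, Real.sqrt_div hN.le, Real.sqrt_sq hX.le,
    Real.sqrt_sq (by positivity)]
  have := Real.sqrt_pos.2 hN
  field_simp
  ring

lemma integral_model {a b : ℝ} (ha : 0 < a) (hab : a < b) :
    ∫ τ in a..b, 1 / (τ * √(((a + b) * τ / (a * b + τ ^ 2)) ^ 2 - 1)) = Real.pi := by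
  have hb : 0 < b := ha.trans hab
  have hd : b - a ≠ 0 := sub_ne_zero.2 hab.ne'
  have hcont : ContinuousOn (fun τ : ℝ => Real.arcsin ((τ - a * b / τ) / (b - a))) (Icc a b) :=
    Real.continuous_arcsin.comp_continuousOn
      ((continuousOn_id.sub (continuousOn_const.div continuousOn_id
        fun x hx => (ha.trans_le hx.1).ne')).div_const _)
  have hderiv := fun x (hx : x ∈ Ioo a b) => hasDerivAt_arcsin_model ha hx
  have hint := intervalIntegral.integrableOn_deriv_of_nonneg hcont hderiv fun x hx => by
    have : 0 < x := ha.trans hx.1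
    positivity
  rw [intervalIntegral.integral_eq_sub_of_hasDerivAt_of_le hab.le hcont hderiv
    ((intervalIntegrable_iff_integrableOn_Ioc_of_le hab.le).2 hint)]
  have h1 : (b - a * b / b) / (b - a) = 1 := by field_simp
  have h2 : (a - a * b / a) / (b - a) = -1 := by
    field_simp
    ring
  rw [h1, h2, Real.arcsin_neg, Real.arcsin_one]
  ring

/-- **Lemma 9.9 (i),(ii),(vi).** Let `0 < a < b < ∞` and
`w₀(τ) = (a+b)τ/(ab + τ²)`.  Then (i) `w₀` is Lipschitz on `[a,b]`, satisfies
`w₀' + (2/(a+b))·w₀² = w₀/τ` on `(a,b)` and `w₀ a = w₀ b = 1`;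
(ii) `sup_{[a,b]} w₀ = (a+b)/(2√(ab))`;
(iii) `∫_a^b dτ/(τ·√(w₀² − 1)) = π`. -/
theorem riccati_model_solution
    (a b : ℝ) (ha : 0 < a) (hab : a < b)
    (w₀ : ℝ → ℝ) (hw₀ : ∀ τ, w₀ τ = (a + b) * τ / (a * b + τ ^ 2)) :
    ((∃ K : NNReal, LipschitzOnWith K w₀ (Set.Icc a b)) ∧
      (∀ τ ∈ Set.Ioo a b,
        HasDerivAt w₀ (w₀ τ / τ - (2 / (a + b)) * w₀ τ ^ 2) τ) ∧
      w₀ a = 1 ∧ w₀ b = 1) ∧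
    sSup (w₀ '' Set.Icc a b) = (a + b) / (2 * Real.sqrt (a * b)) ∧
    (∫ τ in a..b, 1 / (τ * Real.sqrt (w₀ τ ^ 2 - 1))) = Real.pi := by
  obtain rfl : w₀ = fun τ => (a + b) * τ / (a * b + τ ^ 2) := funext hw₀
  have hb : 0 < b := ha.trans hab
  refine ⟨⟨⟨(⟨(a + b) / (a * b), by positivity⟩ : NNReal), ?_⟩, ?_, ?_, ?_⟩,
    (isGreatest_model_image ha hab).csSup_eq, integral_model ha hab⟩
  · exact LipschitzOnWith.of_dist_le_mul fun x hx y hy =>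
      abs_model_sub_le ha hb (ha.trans_le hx.1) (ha.trans_le hy.1)
  · exact fun x hx => hasDerivAt_model ha hb (ha.trans hx.1)
  · field_simp
    ring
  · field_simp
end

section
/- Let 0 < a < b < ∞ and let ϱ : [a,b] → ℝ be a non-negative, non-decreasing, bounded function. Let (w, λ) with w : [a,b] → ℝ Lipschitz and λ ∈ ℝ satisfy w'(x) + λ·w(x)² = (1/x + ϱ(x))·w(x) for a.e. x ∈ (a,b) and w(a) = w(b) = 1. Assume: w is differentiable at a and at b and the differential equation holds at these points; w'(a) > 0 and w'(b) < 0; w > 1 on (a,b); and ϱ is differentiable at a and at b. Then 1/(a·w'(a)) − 1/(b·w'(b)) ≥ 2(a+b)/(b−a), with equality if and only if ϱ vanishes identically on [a,b]. -/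
open MeasureTheory Set Filter

/-- The reciprocal of a Lipschitz function bounded below by `1` is Lipschitz with the same
constant. -/
lemma LipschitzOnWith.inv_of_one_le {s : Set ℝ} {K : NNReal} {w : ℝ → ℝ}
    (hw : LipschitzOnWith K w s) (h1 : ∀ x ∈ s, 1 ≤ w x) :
    LipschitzOnWith K (fun x ↦ (w x)⁻¹) s := by
  refine LipschitzOnWith.of_dist_le_mul fun x hx y hy ↦ le_trans ?_ (hw.dist_le_mul x hx y hy)
  have hx1 := h1 x hx
  have hy1 := h1 y hy
  rw [Real.dist_eq, Real.dist_eq, inv_sub_inv (by positivity) (by positivity), abs_div,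
    abs_sub_comm]
  refine div_le_self (abs_nonneg _) ?_
  rw [abs_of_pos (by positivity)]
  nlinarith

/-- If `w` solves a Riccati equation at `x`, then `t / w t` solves a linear one. -/
lemma HasDerivAt.id_mul_inv_of_riccati {w : ℝ → ℝ} {r lam x : ℝ} (hx : x ≠ 0) (hw : w x ≠ 0)
    (h : HasDerivAt w ((1 / x + r) * w x - lam * w x ^ 2) x) :
    HasDerivAt (fun t ↦ t * (w t)⁻¹) (lam * x - r * (x * (w x)⁻¹)) x := by
  refine ((hasDerivAt_id x).mul (h.inv hw)).congr_deriv ?_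
  simp only [id, Pi.inv_apply]
  field_simp
  ring

/-- An upper bound for the parameter of the Riccati boundary value problem in terms of an upper
bound `c` of the coefficient, strict unless `c = 0`. -/
lemma riccati_param_le {a b lam c : ℝ} (ha : 0 < a) (hab : a < b) {ρ w : ℝ → ℝ}
    (hc : 0 ≤ c) (hρ : ∀ x ∈ Ioo a b, ρ x ≤ c)
    (hac : AbsolutelyContinuousOnInterval (fun t ↦ t * (w t)⁻¹) a b)
    (hw : ContinuousOn w (Icc a b)) (hwpos : ∀ x ∈ Icc a b, 0 < w x)
    (hode : ∀ᵐ x, x ∈ Ioo a b → HasDerivAt w ((1 / x + ρ x) * w x - lam * w x ^ 2) x)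
    (hwa : w a = 1) (hwb : w b = 1) (hw1 : ∀ x ∈ Ioo a b, 1 < w x) :
    lam ≤ 2 / (a + b) + c ∧ (0 < c → lam < 2 / (a + b) + c) := by
  set h : ℝ → ℝ := fun x ↦ c * (x * (1 - (w x)⁻¹)) with h_def
  have h_int : IntervalIntegrable h volume a b := by
    refine ContinuousOn.intervalIntegrable ?_
    rw [uIcc_of_le hab.le]
    exact continuousOn_const.mul
      (continuousOn_id.mul (continuousOn_const.sub (hw.inv₀ fun x hx ↦ (hwpos x hx).ne')))
  have lin_int : IntervalIntegrable (fun x : ℝ ↦ (lam - c) * x) volume a b :=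
    (by fun_prop : Continuous fun x : ℝ ↦ (lam - c) * x).intervalIntegrable a b
  have hpos : ∀ x ∈ Ioo a b, 0 < x * (1 - (w x)⁻¹) := fun x hx ↦
    mul_pos (ha.trans hx.1) (sub_pos.2 (inv_lt_one_of_one_lt₀ (hw1 x hx)))
  have h_le : (fun x ↦ (lam - c) * x + h x) ≤ᵐ[volume.restrict (Icc a b)]
      deriv fun t ↦ t * (w t)⁻¹ := by
    rw [← restrict_Ioo_eq_restrict_Icc, EventuallyLE, ae_restrict_iff' measurableSet_Ioo]
    filter_upwards [hode] with x hx hxI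
    have hx0 : 0 < x := ha.trans hxI.1
    have hwx : 0 < w x := hwpos x (Ioo_subset_Icc_self hxI)
    rw [((hx hxI).id_mul_inv_of_riccati hx0.ne' hwx.ne').deriv]
    have : ρ x * (x * (w x)⁻¹) ≤ c * (x * (w x)⁻¹) :=
      mul_le_mul_of_nonneg_right (hρ x hxI) (by positivity)
    simp only [h_def]
    linarith
  have key := intervalIntegral.integral_mono_ae_restrict hab.le (lin_int.add h_int)
    hac.intervalIntegrable_deriv h_le
  rw [hac.integral_deriv_eq_sub, intervalIntegral.integral_add lin_int h_int,
    intervalIntegral.integral_const_mul, integral_id, hwa, hwb] at key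
  have hsum : 0 < a + b := by linarith
  have hfac : (lam - c) * ((b ^ 2 - a ^ 2) / 2) - (b - a)
      = (b - a) * (a + b) / 2 * (lam - (2 / (a + b) + c)) := by
    field_simp
    ring
  have hC : 0 < (b - a) * (a + b) / 2 := by
    have : 0 < b - a := sub_pos.2 hab
    positivity
  constructor
  · have h0 : 0 ≤ ∫ x in a..b, h x := by
      have h0' := intervalIntegral.integral_mono_on_of_le_Ioo hab.le
        (intervalIntegrable_const (c := (0 : ℝ))) h_int
        fun x hx ↦ mul_nonneg hc (hpos x hx).le
      simpa using h0'
    by_contra! hlt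
    nlinarith [mul_pos hC (sub_pos.2 hlt)]
  · intro hc0
    have h0 : 0 < ∫ x in a..b, h x :=
      intervalIntegral.intervalIntegral_pos_of_pos_on h_int
        (fun x hx ↦ mul_pos hc0 (hpos x hx)) hab
    by_contra! hle
    nlinarith [mul_nonneg hC.le (sub_nonneg.2 hle)]

/-- The parameter of the Riccati boundary value problem with vanishing coefficient. -/
lemma riccati_param_eq {a b lam : ℝ} (ha : 0 < a) (hab : a < b) {ρ w : ℝ → ℝ}
    (hρ : ∀ x ∈ Ioo a b, ρ x = 0)
    (hac : AbsolutelyContinuousOnInterval (fun t ↦ t * (w t)⁻¹) a b)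
    (hwpos : ∀ x ∈ Icc a b, 0 < w x)
    (hode : ∀ᵐ x, x ∈ Ioo a b → HasDerivAt w ((1 / x + ρ x) * w x - lam * w x ^ 2) x)
    (hwa : w a = 1) (hwb : w b = 1) :
    lam = 2 / (a + b) := by
  have key := hac.integral_deriv_eq_sub
  have hcongr : ∫ x in a..b, deriv (fun t ↦ t * (w t)⁻¹) x = ∫ x in a..b, lam * x := by
    rw [intervalIntegral.integral_of_le hab.le, intervalIntegral.integral_of_le hab.le,
      integral_Ioc_eq_integral_Ioo, integral_Ioc_eq_integral_Ioo]
    refine setIntegral_congr_ae measurableSet_Ioo ?_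
    filter_upwards [hode] with x hx hxI
    rw [((hx hxI).id_mul_inv_of_riccati (ha.trans hxI.1).ne'
      (hwpos x (Ioo_subset_Icc_self hxI)).ne').deriv, hρ x hxI]
    ring
  rw [hcongr, intervalIntegral.integral_const_mul, integral_id, hwa, hwb] at key
  have hba : b - a ≠ 0 := (sub_pos.2 hab).ne'
  rw [eq_div_iff (by linarith)]
  apply mul_right_cancel₀ hba
  linarith

/-- The harmonic mean inequality for two numbers, with an upper bound for their sum. -/
lemma four_div_le_one_div_add_one_div {X Y S : ℝ} (hX : 0 < X) (hY : 0 < Y) (hS : X + Y ≤ S) :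
    4 / S ≤ 1 / X + 1 / Y := by
  calc 4 / S ≤ 4 / (X + Y) := by gcongr
    _ ≤ 1 / X + 1 / Y := by
      rw [div_add_div _ _ hX.ne' hY.ne', div_le_div_iff₀ (by positivity) (by positivity)]
      nlinarith [sq_nonneg (X - Y)]

/-- **Lemma 9.11.** Let `0 < a < b < ∞`, `ρ` non-negative non-decreasing bounded
on `[a,b]`, and `(w, lam)` a solution of the Riccati boundary value problem
`w' + lam·w² = (1/x + ρ)·w` a.e. on `(a,b)`, `w a = w b = 1`.  Assume that `w`
is differentiable at `a` and `b` with the equation holding there, that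
`w'(a) > 0` and `w'(b) < 0`, that `w > 1` on `(a,b)`, and that `ρ` is
differentiable at `a` and `b`.  Then
`1/(a·w'(a)) − 1/(b·w'(b)) ≥ 2(a+b)/(b−a)`, with equality iff `ρ ≡ 0` on
`[a,b]`. -/
theorem riccati_endpoint_inequality
    (a b lam : ℝ) (ha : 0 < a) (hab : a < b)
    (ρ w : ℝ → ℝ)
    (hρ0 : ∀ x ∈ Set.Icc a b, 0 ≤ ρ x)
    (hρmono : MonotoneOn ρ (Set.Icc a b))
    (hρbdd : ∃ C, ∀ x ∈ Set.Icc a b, ρ x ≤ C)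
    (hlip : ∃ K : NNReal, LipschitzOnWith K w (Set.Icc a b))
    (hode : ∀ᵐ x ∂MeasureTheory.volume,
      x ∈ Set.Ioo a b → HasDerivAt w ((1 / x + ρ x) * w x - lam * w x ^ 2) x)
    (hwa : w a = 1) (hwb : w b = 1)
    (wa' wb' : ℝ)
    (hda : HasDerivWithinAt w wa' (Set.Icc a b) a)
    (hdb : HasDerivWithinAt w wb' (Set.Icc a b) b)
    (hodea : wa' + lam * w a ^ 2 = (1 / a + ρ a) * w a)
    (hodeb : wb' + lam * w b ^ 2 = (1 / b + ρ b) * w b)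
    (hwa' : 0 < wa') (hwb' : wb' < 0)
    (hw1 : ∀ x ∈ Set.Ioo a b, 1 < w x)
    (hρda : DifferentiableWithinAt ℝ ρ (Set.Icc a b) a)
    (hρdb : DifferentiableWithinAt ℝ ρ (Set.Icc a b) b) :
    2 * (a + b) / (b - a) ≤ 1 / (a * wa') - 1 / (b * wb') ∧
      (1 / (a * wa') - 1 / (b * wb') = 2 * (a + b) / (b - a) ↔
        ∀ x ∈ Set.Icc a b, ρ x = 0) := by
  have haI : a ∈ Icc a b := left_mem_Icc.2 hab.le
  have hbI : b ∈ Icc a b := right_mem_Icc.2 hab.le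
  have hb : 0 < b := ha.trans hab
  have hba : 0 < b - a := sub_pos.2 hab
  have hw1' : ∀ x ∈ Icc a b, 1 ≤ w x := by
    intro x hx
    rcases eq_or_lt_of_le hx.1 with rfl | h1
    · exact hwa.ge
    rcases eq_or_lt_of_le hx.2 with rfl | h2
    · exact hwb.ge
    exact (hw1 x ⟨h1, h2⟩).le
  have hwpos : ∀ x ∈ Icc a b, 0 < w x := fun x hx ↦ one_pos.trans_le (hw1' x hx)
  obtain ⟨K, hK⟩ := hlip
  have hac : AbsolutelyContinuousOnInterval (fun t ↦ t * (w t)⁻¹) a b := by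
    have h1 := hK.inv_of_one_le hw1'
    rw [← uIcc_of_le hab.le] at h1
    exact (LipschitzWith.id.lipschitzOnWith.absolutelyContinuousOnInterval).mul
      h1.absolutelyContinuousOnInterval
  obtain ⟨hle, hlt⟩ := riccati_param_le ha hab (hρ0 b hbI)
    (fun x hx ↦ hρmono (Ioo_subset_Icc_self hx) hbI hx.2.le) hac hK.continuousOn hwpos hode
    hwa hwb hw1
  have hρab : ρ a ≤ ρ b := hρmono haI hbI hab.le
  have hX : a * wa' = 1 + a * ρ a - lam * a := by
    have : wa' = 1 / a + ρ a - lam := by rw [hwa] at hodea; linarith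
    rw [this]
    field_simp
  have hY : b * -wb' = lam * b - 1 - b * ρ b := by
    have : wb' = 1 / b + ρ b - lam := by rw [hwb] at hodeb; linarith
    rw [this]
    field_simp
    ring
  have hXpos : 0 < a * wa' := mul_pos ha hwa'
  have hYpos : 0 < b * -wb' := mul_pos hb (neg_pos.2 hwb')
  have hsum : a * wa' + b * -wb' ≤ (b - a) * (lam - ρ b) := by
    nlinarith [mul_le_mul_of_nonneg_left hρab ha.le]
  have hlhs : 1 / (a * wa') - 1 / (b * wb') = 1 / (a * wa') + 1 / (b * -wb') := by
    rw [mul_neg, one_div_neg_eq_neg_one_div, sub_eq_add_neg]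
  have hrhs : 2 * (a + b) / (b - a) = 4 / ((b - a) * (2 / (a + b))) := by
    field_simp
    norm_num
  rw [hlhs, hrhs]
  refine ⟨four_div_le_one_div_add_one_div hXpos hYpos (hsum.trans ?_), fun heq ↦ ?_, fun h0 ↦ ?_⟩
  · exact mul_le_mul_of_nonneg_left (by linarith) hba.le
  · have hρb : ρ b = 0 := by
      refine le_antisymm (not_lt.1 fun hpos ↦ ?_) (hρ0 b hbI)
      have hS := four_div_le_one_div_add_one_div hXpos hYpos hsum
      have hS0 : 0 < (b - a) * (lam - ρ b) := by linarith
      have hSlt : (b - a) * (lam - ρ b) < (b - a) * (2 / (a + b)) :=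
        mul_lt_mul_of_pos_left (by linarith [hlt hpos]) hba
      have := div_lt_div_of_pos_left (four_pos (α := ℝ)) hS0 hSlt
      linarith
    exact fun x hx ↦ le_antisymm (hρb ▸ hρmono hx hbI hx.2) (hρ0 x hx)
  · have hlam := riccati_param_eq ha hab (fun x hx ↦ h0 x (Ioo_subset_Icc_self hx)) hac hwpos
      hode hwa hwb
    have hXv : a * wa' = (b - a) / (a + b) := by
      rw [hX, h0 a haI, hlam]
      field_simp
      ring
    have hYv : b * -wb' = (b - a) / (a + b) := by
      rw [hY, h0 b hbI, hlam]
      field_simp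
      ring
    rw [hXv, hYv]
    field_simp
    norm_num
end

section
/- Let 0 < b < ∞ and let ϱ : [0,b] → ℝ be a non-negative, non-decreasing, bounded function. Then: (i) there exists a pair (u, λ) with u : [0,b] → ℝ Lipschitz and λ ∈ ℝ such that u'(x) + (1/x + ϱ(x))·u(x) + λ = 0 for a.e. x ∈ (0,b), u(0) = 0 and u(b) = 1; (ii) λ = −g(b)/∫_0^b g(s) ds, where g(x) := x·e^{h(x)} and h is a primitive of ϱ on [0,b]; (iii) the pair (u, λ) is unique; (iv) u > 0 on (0,b]. -/
open MeasureTheory Set Filter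

/-- A pair `(u, lam)` solves the boundary value problem (9.12):
`u` is Lipschitz on `[0,b]`, `u' + (1/x + ρ x)·u + lam = 0` a.e. on `(0,b)`,
`u 0 = 0` and `u b = 1`. -/
def IsLinSolZero (b lam : ℝ) (ρ u : ℝ → ℝ) : Prop :=
  (∃ K : NNReal, LipschitzOnWith K u (Set.Icc 0 b)) ∧
    (∀ᵐ x ∂MeasureTheory.volume,
      x ∈ Set.Ioo (0 : ℝ) b → HasDerivAt u (-((1 / x + ρ x) * u x + lam)) x) ∧
    u 0 = 0 ∧ u b = 1

/-- The integral of a function monotone on `[0,b]` grows on `[x,y]` by at least `f x * (y - x)` and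
by at most `f y * (y - x)`. -/
lemma MonotoneOn.integral_sub_integral_mem_Icc {b x y : ℝ} {f : ℝ → ℝ}
    (hf : MonotoneOn f (Icc 0 b)) (hx : 0 ≤ x) (hxy : x ≤ y) (hy : y ≤ b) :
    (∫ t in (0 : ℝ)..y, f t) - ∫ t in (0 : ℝ)..x, f t ∈
      Icc (f x * (y - x)) (f y * (y - x)) := by
  have hint : ∀ {c d : ℝ}, 0 ≤ c → c ≤ d → d ≤ b → IntervalIntegrable f volume c d :=
    fun hc hcd hd => MonotoneOn.intervalIntegrable <|
      hf.mono (by rw [uIcc_of_le hcd]; exact Icc_subset_Icc hc hd)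
  have hxb : x ∈ Icc 0 b := ⟨hx, hxy.trans hy⟩
  have hyb : y ∈ Icc 0 b := ⟨hx.trans hxy, hy⟩
  rw [intervalIntegral.integral_interval_sub_left (hint le_rfl hyb.1 hy)
    (hint le_rfl hx hxb.2)]
  constructor
  · have := intervalIntegral.integral_mono_on (μ := volume) (f := fun _ => f x) hxy
      intervalIntegrable_const (hint hx hxy hy)
      (fun t ht => hf hxb ⟨hx.trans ht.1, ht.2.trans hy⟩ ht.1)
    simpa [mul_comm] using this
  · have := intervalIntegral.integral_mono_on (μ := volume) (g := fun _ => f y) hxy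
      (hint hx hxy hy) intervalIntegrable_const
      (fun t ht => hf ⟨hx.trans ht.1, ht.2.trans hy⟩ hyb ht.2)
    simpa [mul_comm] using this

lemma exists_lipschitzOnWith_of_forall_le {b M : ℝ} {f : ℝ → ℝ}
    (hf : ∀ x y, 0 ≤ x → x ≤ y → y ≤ b → |f y - f x| ≤ M * (y - x)) :
    ∃ K : NNReal, LipschitzOnWith K f (Icc 0 b) := by
  refine ⟨_, LipschitzOnWith.of_dist_le' (K := M) fun x hx y hy => ?_⟩
  rw [Real.dist_eq, Real.dist_eq]
  rcases le_total x y with hxy | hxy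
  · rw [abs_sub_comm (f x), abs_sub_comm x, abs_of_nonneg (sub_nonneg.2 hxy)]
    exact hf x y hx.1 hxy hy.2
  · rw [abs_of_nonneg (sub_nonneg.2 hxy)]
    exact hf y x hy.1 hxy hx.2

/-- If the positive monotone function `g` vanishes at `0` and has increments controlled by
`g y * (y - x) / y`, then `x ↦ (∫ t in 0..x, g t) / g x` is Lipschitz. -/
lemma exists_lipschitzOnWith_integral_div {b M : ℝ} {g : ℝ → ℝ} (hM : 1 ≤ M)
    (hg0 : g 0 = 0) (hpos : ∀ x ∈ Ioc 0 b, 0 < g x) (hmono : MonotoneOn g (Icc 0 b))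
    (hinc : ∀ x y, 0 ≤ x → x ≤ y → y ≤ b → y * (g y - g x) ≤ M * (y - x) * g y) :
    ∃ K : NNReal, LipschitzOnWith K (fun x => (∫ t in (0 : ℝ)..x, g t) / g x) (Icc 0 b) := by
  refine exists_lipschitzOnWith_of_forall_le (M := M) fun x y hx hxy hy => ?_
  rcases hxy.eq_or_lt with rfl | hlt
  · simp
  have hypos : 0 < y := hx.trans_lt hlt
  have hgy : 0 < g y := hpos y ⟨hypos, hy⟩
  obtain ⟨h1, h2⟩ := hmono.integral_sub_integral_mem_Icc hx hxy hy
  have hgxy : g x ≤ g y := hmono ⟨hx, hxy.trans hy⟩ ⟨hypos.le, hy⟩ hxy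
  have hyx : 0 ≤ y - x := sub_nonneg.2 hxy
  rcases hx.eq_or_lt with rfl | hxpos
  · simp only [intervalIntegral.integral_same, hg0, div_zero, sub_zero, zero_mul] at h1 h2 ⊢
    rw [abs_of_nonneg (by positivity), div_le_iff₀ hgy]
    nlinarith [mul_le_mul_of_nonneg_right hM (mul_pos hgy hypos).le]
  have hgx : 0 < g x := hpos x ⟨hxpos, hxy.trans hy⟩
  obtain ⟨h3, h4⟩ := hmono.integral_sub_integral_mem_Icc le_rfl hx (hxy.trans hy)
  simp only [intervalIntegral.integral_same, hg0, sub_zero, zero_mul] at h3 h4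
  set G := fun x => ∫ t in (0 : ℝ)..x, g t
  change 0 ≤ G x at h3
  change G x ≤ _ at h4
  change _ ≤ G y - G x at h1
  change G y - G x ≤ _ at h2
  change |G y / g y - G x / g x| ≤ _
  have h5 : 0 ≤ G y - G x := h1.trans' (mul_nonneg hgx.le hyx)
  have hsplit : G y / g y - G x / g x = (G y - G x) / g y - G x / g x * ((g y - g x) / g y) := by
    field_simp
    ring
  have hA : (G y - G x) / g y ≤ M * (y - x) := by
    rw [div_le_iff₀ hgy]
    nlinarith [mul_le_mul_of_nonneg_right hM (mul_nonneg hgy.le hyx)]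
  have hA0 : 0 ≤ (G y - G x) / g y := by positivity
  have hB0 : 0 ≤ G x / g x * ((g y - g x) / g y) :=
    mul_nonneg (by positivity) (div_nonneg (sub_nonneg.2 hgxy) hgy.le)
  have hB : G x / g x * ((g y - g x) / g y) ≤ M * (y - x) := by
    calc G x / g x * ((g y - g x) / g y) ≤ y * ((g y - g x) / g y) := by
          refine mul_le_mul_of_nonneg_right ?_ (div_nonneg (sub_nonneg.2 hgxy) hgy.le)
          rw [div_le_iff₀ hgx]
          nlinarith
      _ ≤ M * (y - x) := by
          rw [← mul_div_assoc, div_le_iff₀ hgy]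
          exact hinc x y hx hxy hy
  rw [hsplit, abs_le]
  constructor <;> linarith

/-- If `g` is an integrating factor, `g' = (1/x + ρ) g` a.e., then every solution of the boundary
value problem satisfies `g u = -lam ∫ g`. -/
lemma IsLinSolZero.mul_eq {b lam : ℝ} {ρ u g : ℝ → ℝ} (hb : 0 < b) (hu : IsLinSolZero b lam ρ u)
    (hg0 : g 0 = 0) (hlip : ∃ K : NNReal, LipschitzOnWith K g (Icc 0 b))
    (hderiv : ∀ᵐ x, x ∈ Ioo 0 b → HasDerivAt g ((1 / x + ρ x) * g x) x)
    {x : ℝ} (hx : x ∈ Icc 0 b) :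
    g x * u x = -lam * ∫ t in (0 : ℝ)..x, g t := by
  obtain ⟨⟨K, hK⟩, hode, hu0, -⟩ := hu
  obtain ⟨L, hL⟩ := hlip
  rw [← uIcc_of_le hb.le] at hK hL hx
  have hint : IntervalIntegrable g volume 0 b := hL.continuousOn.intervalIntegrable
  have hac : AbsolutelyContinuousOnInterval
      (fun x => g x * u x + lam * ∫ t in (0 : ℝ)..x, g t) 0 b :=
    (hL.absolutelyContinuousOnInterval.mul hK.absolutelyContinuousOnInterval).add
      ((hint.absolutelyContinuousOnInterval_intervalIntegral left_mem_uIcc).const_mul lam)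
  have hne : ∀ c : ℝ, ∀ᵐ x : ℝ, x ≠ c := fun c => by simp [ae_iff, measure_singleton]
  obtain ⟨c, hc⟩ := hac.const_of_ae_hasDerivAt_zero (by
    filter_upwards [hode, hderiv, hint.ae_hasDerivAt_integral, hne 0, hne b]
      with x h1 h2 h3 hx0 hxb hx
    have hxo : x ∈ Ioo 0 b := by
      rw [uIcc_of_le hb.le] at hx
      exact ⟨hx.1.lt_of_ne' hx0, hx.2.lt_of_ne hxb⟩
    convert! ((h2 hxo).mul (h1 hxo)).add ((h3 hx 0 left_mem_uIcc).const_mul lam) using 1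
    ring)
  have h0 := hc 0 left_mem_uIcc
  have hx' := hc x hx
  simp only [hg0, intervalIntegral.integral_same] at h0 hx'
  linarith

/-- **Lemma 9.17.** Let `0 < b < ∞`, `ρ` non-negative non-decreasing bounded on
`[0,b]`, `h` a primitive of `ρ` and `g x = x e^{h x}`.  Then (i) the boundary
value problem (9.12) has a solution `(u, lam)`; (ii) `lam = −g(b)/∫_0^b g`;
(iii) the pair `(u, lam)` is unique; (iv) `u > 0` on `(0,b]`. -/
theorem linear_bvp_zero_existence_uniqueness
    (b : ℝ) (hb : 0 < b)
    (ρ h g : ℝ → ℝ)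
    (hρ0 : ∀ x ∈ Set.Icc (0 : ℝ) b, 0 ≤ ρ x)
    (hρmono : MonotoneOn ρ (Set.Icc (0 : ℝ) b))
    (hρbdd : ∃ C, ∀ x ∈ Set.Icc (0 : ℝ) b, ρ x ≤ C)
    (hprim : ∀ x ∈ Set.Icc (0 : ℝ) b, h x = h 0 + ∫ t in (0 : ℝ)..x, ρ t)
    (hg : ∀ x ∈ Set.Icc (0 : ℝ) b, g x = x * Real.exp (h x)) :
    (∃ u lam, IsLinSolZero b lam ρ u) ∧
    (∀ u lam, IsLinSolZero b lam ρ u →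
        lam = -(g b / ∫ s in (0 : ℝ)..b, g s)) ∧
    (∀ u₁ lam₁ u₂ lam₂, IsLinSolZero b lam₁ ρ u₁ → IsLinSolZero b lam₂ ρ u₂ →
        lam₁ = lam₂ ∧ ∀ x ∈ Set.Icc (0 : ℝ) b, u₁ x = u₂ x) ∧
    (∀ u lam, IsLinSolZero b lam ρ u → ∀ x ∈ Set.Ioc (0 : ℝ) b, 0 < u x) := by
  obtain ⟨C, hC⟩ := hρbdd
  have h0mem : (0 : ℝ) ∈ Icc 0 b := left_mem_Icc.2 hb.le
  have hbmem : b ∈ Icc 0 b := right_mem_Icc.2 hb.le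
  have hC0 : 0 ≤ C := (hρ0 0 h0mem).trans (hC 0 h0mem)
  have hhinc : ∀ x y, 0 ≤ x → x ≤ y → y ≤ b → h x ≤ h y ∧ h y - h x ≤ C * (y - x) := by
    intro x y hx hxy hy
    have hxm : x ∈ Icc 0 b := ⟨hx, hxy.trans hy⟩
    have hym : y ∈ Icc 0 b := ⟨hx.trans hxy, hy⟩
    obtain ⟨h1, h2⟩ := hρmono.integral_sub_integral_mem_Icc hx hxy hy
    have hyx : 0 ≤ y - x := sub_nonneg.2 hxy
    rw [hprim x hxm, hprim y hym]
    exact ⟨by linarith [mul_nonneg (hρ0 x hxm) hyx],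
      by linarith [mul_le_mul_of_nonneg_right (hC y hym) hyx]⟩
  have hg0 : g 0 = 0 := by simp [hg 0 h0mem]
  have hpos : ∀ x ∈ Ioc 0 b, 0 < g x := fun x hx => by
    rw [hg x ⟨hx.1.le, hx.2⟩]
    exact mul_pos hx.1 (Real.exp_pos _)
  have hmono : MonotoneOn g (Icc 0 b) := fun x hx y hy hxy => by
    rw [hg x hx, hg y hy]
    exact mul_le_mul hxy (Real.exp_le_exp.2 (hhinc x y hx.1 hxy hy.2).1) (Real.exp_pos _).le hy.1
  have hginc : ∀ x y, 0 ≤ x → x ≤ y → y ≤ b →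
      g y - g x ≤ (1 + b * C) * (y - x) * Real.exp (h y) := by
    intro x y hx hxy hy
    rw [hg x ⟨hx, hxy.trans hy⟩, hg y ⟨hx.trans hxy, hy⟩]
    have hexp : Real.exp (h y) * (1 - C * (y - x)) ≤ Real.exp (h x) := by
      rw [show h x = h y + (h x - h y) by ring, Real.exp_add]
      refine mul_le_mul_of_nonneg_left ?_ (Real.exp_pos _).le
      linarith [Real.add_one_le_exp (h x - h y), (hhinc x y hx hxy hy).2]
    have h1 := mul_le_mul_of_nonneg_left hexp hx
    have h2 : x * (C * (y - x) * Real.exp (h y)) ≤ b * (C * (y - x) * Real.exp (h y)) :=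
      mul_le_mul_of_nonneg_right (hxy.trans hy)
        (mul_nonneg (mul_nonneg hC0 (sub_nonneg.2 hxy)) (Real.exp_pos _).le)
    linarith
  have hglip : ∃ K : NNReal, LipschitzOnWith K g (Icc 0 b) := by
    refine exists_lipschitzOnWith_of_forall_le (M := (1 + b * C) * Real.exp (h b))
      fun x y hx hxy hy => ?_
    have hym : y ∈ Icc 0 b := ⟨hx.trans hxy, hy⟩
    rw [abs_of_nonneg (sub_nonneg.2 (hmono ⟨hx, hxy.trans hy⟩ hym hxy))]
    refine (hginc x y hx hxy hy).trans ?_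
    rw [mul_right_comm]
    have := (hhinc y b hym.1 hy le_rfl).1
    have hyx : 0 ≤ y - x := sub_nonneg.2 hxy
    gcongr
  have hρint : IntervalIntegrable ρ volume 0 b :=
    MonotoneOn.intervalIntegrable (by rwa [uIcc_of_le hb.le])
  have hgderiv : ∀ᵐ x, x ∈ Ioo 0 b → HasDerivAt g ((1 / x + ρ x) * g x) x := by
    filter_upwards [hρint.ae_hasDerivAt_integral] with x hx hxo
    have hxm : x ∈ Icc 0 b := Ioo_subset_Icc_self hxo
    have hIcc : ∀ᶠ y in nhds x, y ∈ Icc 0 b := Icc_mem_nhds hxo.1 hxo.2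
    rw [uIcc_of_le hb.le] at hx
    have hh : HasDerivAt h (ρ x) x :=
      ((hx hxm 0 h0mem).const_add (h 0)).congr_of_eventuallyEq (hIcc.mono hprim)
    convert! ((hasDerivAt_id x).mul hh.exp).congr_of_eventuallyEq (hIcc.mono hg) using 1
    have := hxo.1.ne'
    rw [hg x hxm]
    simp only [id]
    field_simp
  have hgint : IntervalIntegrable g volume 0 b :=
    MonotoneOn.intervalIntegrable (by rwa [uIcc_of_le hb.le])
  have hGpos : ∀ x ∈ Ioc 0 b, 0 < ∫ t in (0 : ℝ)..x, g t := fun x hx =>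
    intervalIntegral.intervalIntegral_pos_of_pos_on
      (hgint.mono_set (by
        rw [uIcc_of_le hb.le, uIcc_of_le hx.1.le]; exact Icc_subset_Icc_right hx.2))
      (fun t ht => hpos t ⟨ht.1, ht.2.le.trans hx.2⟩) hx.1
  have hGb := hGpos b ⟨hb, le_rfl⟩
  have hgb := hpos b ⟨hb, le_rfl⟩
  have hlam : ∀ u lam, IsLinSolZero b lam ρ u → lam = -(g b / ∫ s in (0 : ℝ)..b, g s) := by
    intro u lam hu
    have key := hu.mul_eq hb hg0 hglip hgderiv hbmem
    rw [hu.2.2.2, mul_one] at key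
    rw [key, mul_div_cancel_right₀ _ hGb.ne', neg_neg]
  have huval : ∀ u lam, IsLinSolZero b lam ρ u → ∀ x ∈ Ioc 0 b,
      u x = (g b / ∫ s in (0 : ℝ)..b, g s) * ((∫ t in (0 : ℝ)..x, g t) / g x) := by
    intro u lam hu x hx
    have key := hu.mul_eq hb hg0 hglip hgderiv ⟨hx.1.le, hx.2⟩
    rw [hlam u lam hu, neg_neg] at key
    rw [← mul_div_assoc, eq_div_iff (hpos x hx).ne', mul_comm, key]
  refine ⟨⟨fun x => (g b / ∫ s in (0 : ℝ)..b, g s) * ((∫ t in (0 : ℝ)..x, g t) / g x),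
      -(g b / ∫ s in (0 : ℝ)..b, g s), ?_, ?_, by simp, ?_⟩, hlam, ?_, ?_⟩
  · obtain ⟨K, hK⟩ := exists_lipschitzOnWith_integral_div (M := 1 + b * C)
      (le_add_of_nonneg_right (mul_nonneg hb.le hC0)) hg0 hpos hmono (fun x y hx hxy hy => by
        have := mul_le_mul_of_nonneg_left (hginc x y hx hxy hy) (hx.trans hxy)
        rw [hg y ⟨hx.trans hxy, hy⟩] at this ⊢
        linarith)
    exact ⟨_, (LipschitzWith.of_dist_le' (K := |g b / ∫ s in (0 : ℝ)..b, g s|) fun x y => by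
      rw [Real.dist_eq, Real.dist_eq, ← mul_sub, abs_mul]).comp_lipschitzOnWith hK⟩
  · filter_upwards [hgderiv, hgint.ae_hasDerivAt_integral] with x h1 h2 hxo
    have hgx := (hpos x ⟨hxo.1, hxo.2.le⟩).ne'
    have hx : x ∈ uIcc 0 b := by
      rw [uIcc_of_le hb.le]
      exact Ioo_subset_Icc_self hxo
    convert! ((h2 hx 0 left_mem_uIcc).div (h1 hxo) hgx).const_mul
      (g b / ∫ s in (0 : ℝ)..b, g s) using 1
    have := hxo.1.ne'
    field_simp
    ring
  · field_simp
  · intro u₁ lam₁ u₂ lam₂ hu₁ hu₂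
    refine ⟨(hlam _ _ hu₁).trans (hlam _ _ hu₂).symm, fun x hx => ?_⟩
    rcases hx.1.eq_or_lt with rfl | hx0
    · rw [hu₁.2.2.1, hu₂.2.2.1]
    · rw [huval _ _ hu₁ x ⟨hx0, hx.2⟩, huval _ _ hu₂ x ⟨hx0, hx.2⟩]
  · intro u lam hu x hx
    rw [huval u lam hu x hx]
    exact mul_pos (div_pos hgb hGb) (div_pos (hGpos x hx) (hpos x hx))
end
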